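/- arXiv:1309.1970 — 4 statements merged into one kernel-verified Lean document; each statement's English description precedes it below -/
import Mathlib

section
/- Assume m ≥ 2, n ≥ 2, U ⊆ ℝ^m open and connected, H(u) = H0 + u1·H1 + ⋯ + um·Hm with H0,…,Hm Hermitian n×n complex matrices, and that the spectrum of H(·) is conically connected. Then there exists a subset Ū ⊆ U that is dense in U and whose complement in U has Lebesgue measure zero, such that for every ū ∈ Ū and every vector (α1,…,αn) ∈ ℚ^n satisfying α1·λ1(ū) + ⋯ + αn·λn(ū) = 0 one has α1 = α2 = ⋯ = αn. -/
open scoped BigOperators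

/-- The control-affine Hamiltonian `H(u) = H0 + u 1 • H1 + ⋯ + u m • Hm`. -/
noncomputable def controlHam {n m : ℕ} (H0 : Matrix (Fin n) (Fin n) ℂ)
    (Hc : Fin m → Matrix (Fin n) (Fin n) ℂ) (u : EuclideanSpace ℝ (Fin m)) :
    Matrix (Fin n) (Fin n) ℂ :=
  H0 + ∑ i, (u i : ℂ) • Hc i

/-- `lam u 0 ≤ ⋯ ≤ lam u (n-1)` are the eigenvalues of `H(u)`, repeated according to
their multiplicities, for every `u ∈ U`:  `lam u` is monotone and the characteristic
polynomial of `H(u)` is `∏ j, (X - lam u j)`. -/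
def IsOrderedSpectrum {n m : ℕ} (H0 : Matrix (Fin n) (Fin n) ℂ)
    (Hc : Fin m → Matrix (Fin n) (Fin n) ℂ) (U : Set (EuclideanSpace ℝ (Fin m)))
    (lam : EuclideanSpace ℝ (Fin m) → Fin n → ℝ) : Prop :=
  ∀ u ∈ U, Monotone (lam u) ∧
    (controlHam H0 Hc u).charpoly = ∏ j, (Polynomial.X - Polynomial.C ((lam u j : ℂ)))

/-- The eigenvalue `lam ubar l` is a simple eigenvalue. -/
def SimpleEigAt {n m : ℕ} (lam : EuclideanSpace ℝ (Fin m) → Fin n → ℝ)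
    (ubar : EuclideanSpace ℝ (Fin m)) (l : Fin n) : Prop :=
  ∀ l' : Fin n, lam ubar l' = lam ubar l → l' = l

/-- `ubar ∈ U` is a conical intersection between the (consecutive) eigenvalues
`lam · j` and `lam · k`:  they coincide at `ubar`, the common value is an eigenvalue of
multiplicity two, and the gap opens at least linearly in every direction. -/
def ConicalAt {n m : ℕ} (U : Set (EuclideanSpace ℝ (Fin m)))
    (lam : EuclideanSpace ℝ (Fin m) → Fin n → ℝ) (j k : Fin n)
    (ubar : EuclideanSpace ℝ (Fin m)) : Prop :=
  ubar ∈ U ∧ lam ubar j = lam ubar k ∧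
  (∀ l : Fin n, lam ubar l = lam ubar j ↔ (l = j ∨ l = k)) ∧
  ∃ c > (0 : ℝ), ∀ v : EuclideanSpace ℝ (Fin m), ‖v‖ = 1 →
    ∃ ε > (0 : ℝ), ∀ t : ℝ, 0 < t → t < ε →
      lam (ubar + t • v) k - lam (ubar + t • v) j > c * t

/-- The spectrum is conically connected: every eigenvalue intersection is conical, and
every pair of subsequent eigenvalues admits a conical intersection at which all the
other eigenvalues are simple. -/
def ConicallyConnected {n m : ℕ} (U : Set (EuclideanSpace ℝ (Fin m)))
    (lam : EuclideanSpace ℝ (Fin m) → Fin n → ℝ) : Prop :=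
  (∀ ubar ∈ U, ∀ j k : Fin n, (j : ℕ) + 1 = (k : ℕ) → lam ubar j = lam ubar k →
    ConicalAt U lam j k ubar) ∧
  (∀ j k : Fin n, (j : ℕ) + 1 = (k : ℕ) → ∃ ubar : EuclideanSpace ℝ (Fin m),
    ConicalAt U lam j k ubar ∧ ∀ l : Fin n, l ≠ j → l ≠ k → SimpleEigAt lam ubar l)

section PartA

theorem aux_weyl {n : ℕ} {E : Type*} [NormedAddCommGroup E] [InnerProductSpace ℂ E]
    (e f : OrthonormalBasis (Fin n) ℂ E) (T S : E →ₗ[ℂ] E) (a b : Fin n → ℝ)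
    (ha : Monotone a) (hb : Monotone b)
    (hT : ∀ i, T (e i) = (a i : ℂ) • e i) (hS : ∀ i, S (f i) = (b i : ℂ) • f i)
    (δ : ℝ) (hδ : ∀ x, ‖T x - S x‖ ≤ δ * ‖x‖) (j : Fin n) : b j ≤ a j + δ := by
  classical
  have quad : ∀ (e : OrthonormalBasis (Fin n) ℂ E) (T : E →ₗ[ℂ] E) (a : Fin n → ℝ),
      (∀ i, T (e i) = (a i : ℂ) • e i) → ∀ x,
      (inner ℂ x (T x)).re = ∑ i, a i * ‖inner ℂ (e i) x‖ ^ 2 := by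
    intro e T a hT x
    have h1 : T x = ∑ i, ((a i : ℂ) * inner ℂ (e i) x) • e i := by
      conv_lhs => rw [← e.sum_repr' x]
      rw [map_sum]
      refine Finset.sum_congr rfl fun i _ => ?_
      rw [map_smul, hT, smul_smul, mul_comm]
    rw [h1, inner_sum, Complex.re_sum]
    refine Finset.sum_congr rfl fun i _ => ?_
    rw [inner_smul_right, mul_assoc, ← inner_conj_symm x (e i), Complex.mul_conj,
      Complex.normSq_eq_norm_sq]
    norm_cast
  have nsq : ∀ (e : OrthonormalBasis (Fin n) ℂ E) (x : E), ‖x‖ ^ 2 = ∑ i, ‖inner ℂ (e i) x‖ ^ 2 :=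
    fun e x => (e.sum_sq_norm_inner_right x).symm
  let L : E →ₗ[ℂ] (Fin n → ℂ) := LinearMap.pi fun i =>
    if i < j then (innerSL ℂ (f i)).toLinearMap else if j < i then (innerSL ℂ (e i)).toLinearMap else 0
  have : FiniteDimensional ℂ E := Module.Basis.finiteDimensional_of_finite e.toBasis
  have hfr : Module.finrank ℂ E = Module.finrank ℂ (Fin n → ℂ) := by
    rw [Module.finrank_eq_card_basis e.toBasis]; simp
  have hLs : ¬ Function.Surjective L := by
    intro h
    obtain ⟨x, hx⟩ := h (Pi.single j 1)
    have := congrFun hx j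
    simp [L] at this
  have hLi : ¬ Function.Injective L := fun h =>
    hLs ((LinearMap.injective_iff_surjective_of_finrank_eq_finrank hfr).1 h)
  obtain ⟨x, hx0, hx⟩ : ∃ x, x ≠ 0 ∧ L x = 0 := by
    by_contra hcon
    push Not at hcon
    exact hLi ((injective_iff_map_eq_zero L).2 fun x hx => by
      by_contra h; exact hcon x h hx)
  have hf0 : ∀ i, i < j → inner ℂ (f i) x = 0 := fun i hi => by
    have := congrFun hx i
    simpa [L, hi] using this
  have he0 : ∀ i, j < i → inner ℂ (e i) x = 0 := fun i hi => by
    have := congrFun hx i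
    simpa [L, hi, not_lt_of_gt hi] using this
  have h1 : (inner ℂ x (T x)).re ≤ a j * ‖x‖ ^ 2 := by
    rw [quad e T a hT, nsq e x, Finset.mul_sum]
    refine Finset.sum_le_sum fun i _ => ?_
    rcases le_or_gt i j with h | h
    · exact mul_le_mul_of_nonneg_right (ha h) (by positivity)
    · simp [he0 i h]
  have h2 : b j * ‖x‖ ^ 2 ≤ (inner ℂ x (S x)).re := by
    rw [quad f S b hS, nsq f x, Finset.mul_sum]
    refine Finset.sum_le_sum fun i _ => ?_
    rcases le_or_gt j i with h | h
    · exact mul_le_mul_of_nonneg_right (hb h) (by positivity)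
    · simp [hf0 i h]
  have h3 : (inner ℂ x (S x)).re - (inner ℂ x (T x)).re ≤ δ * ‖x‖ ^ 2 := by
    rw [← Complex.sub_re, ← inner_sub_right]
    calc _ ≤ ‖inner ℂ x (S x - T x)‖ := Complex.re_le_norm _
      _ ≤ ‖x‖ * ‖S x - T x‖ := norm_inner_le_norm _ _
      _ ≤ ‖x‖ * (δ * ‖x‖) := by
        gcongr; rw [norm_sub_rev]; exact hδ x
      _ = _ := by ring
  have h4 : 0 < ‖x‖ ^ 2 := by positivity
  have h5 : b j * ‖x‖ ^ 2 ≤ (a j + δ) * ‖x‖ ^ 2 := by linarith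
  exact le_of_mul_le_mul_right h5 h4

theorem aux_basis {n : ℕ} (A : Matrix (Fin n) (Fin n) ℂ) (hA : A.IsHermitian) (a : Fin n → ℝ)
    (ha : Monotone a)
    (hc : A.charpoly = ∏ j, (Polynomial.X - Polynomial.C ((a j : ℂ)))) :
    ∃ e : OrthonormalBasis (Fin n) ℂ (EuclideanSpace ℂ (Fin n)),
      ∀ i, Matrix.toEuclideanLin A (e i) = (a i : ℂ) • e i := by
  have hT : (Matrix.toEuclideanLin A).IsSymmetric := Matrix.isSymmetric_toEuclideanLin_iff.2 hA
  have hn : Module.finrank ℂ (EuclideanSpace ℂ (Fin n)) = n := by simp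
  have hch : (Matrix.toEuclideanLin A).charpoly = A.charpoly := by
    rw [Matrix.toEuclideanLin_eq_toLin]
    exact Matrix.charpoly_toLin _ _
  have h1 : List.ofFn (hT.eigenvalues hn) = List.ofFn (a ∘ Fin.rev) := by
    rw [← hT.sort_roots_charpoly_eq_eigenvalues, hch, hc, Polynomial.roots_prod _ _ (by
      simp [Finset.prod_ne_zero_iff, Polynomial.X_sub_C_ne_zero])]
    have hs : (List.ofFn (a ∘ Fin.rev)).Pairwise (· ≥ ·) := by
      rw [← List.sortedGE_iff_pairwise]
      refine Antitone.sortedGE_ofFn ?_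
      exact ha.comp_antitone Fin.rev_anti
    have hm : Multiset.map (RCLike.re : ℂ → ℝ) (Finset.univ.val.bind fun i =>
        (Polynomial.X - Polynomial.C ((a i : ℂ))).roots) = (List.ofFn (a ∘ Fin.rev) : Multiset ℝ) := by
      simp only [Polynomial.roots_X_sub_C, Multiset.bind_singleton, Multiset.map_map]
      rw [← Fin.univ_val_map]
      rw [show (a ∘ Fin.rev) = a ∘ Fin.revPerm from rfl, ← Multiset.map_map a]
      congr 1
      exact (congrArg Finset.val (Finset.map_univ_equiv (Fin.revPerm (n := n)))).symm
    rw [hm, Multiset.coe_sort]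
    exact List.mergeSort_of_pairwise (by simpa using hs)
  have h2 := List.ofFn_injective h1
  refine ⟨(hT.eigenvectorBasis hn).reindex Fin.revPerm, fun i => ?_⟩
  have := hT.apply_eigenvectorBasis hn (Fin.rev i)
  rw [h2] at this
  simpa using this

theorem aux_herm {n m : ℕ} (H0 : Matrix (Fin n) (Fin n) ℂ) (Hc : Fin m → Matrix (Fin n) (Fin n) ℂ)
    (hH0 : H0.IsHermitian) (hHc : ∀ i, (Hc i).IsHermitian) (u : EuclideanSpace ℝ (Fin m)) :
    (controlHam H0 Hc u).IsHermitian := by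
  unfold controlHam Matrix.IsHermitian
  rw [Matrix.conjTranspose_add, Matrix.conjTranspose_sum, hH0.eq]
  congr 1
  refine Finset.sum_congr rfl fun i _ => ?_
  rw [Matrix.conjTranspose_smul, (hHc i).eq]
  simp

theorem aux_lip {n m : ℕ} (H0 : Matrix (Fin n) (Fin n) ℂ) (Hc : Fin m → Matrix (Fin n) (Fin n) ℂ)
    (hH0 : H0.IsHermitian) (hHc : ∀ i, (Hc i).IsHermitian) (U : Set (EuclideanSpace ℝ (Fin m)))
    (lam : EuclideanSpace ℝ (Fin m) → Fin n → ℝ)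
    (hlam : IsOrderedSpectrum H0 Hc U lam) :
    ∃ L : ℝ, 0 < L ∧ ∀ u ∈ U, ∀ w ∈ U, ∀ j, |lam u j - lam w j| ≤ L * ‖u - w‖ := by
  let N : Fin m → ℝ := fun i => ‖(Matrix.toEuclideanLin (Hc i)).toContinuousLinearMap‖
  refine ⟨∑ i, N i + 1, by positivity, ?_⟩
  have key : ∀ u ∈ U, ∀ w ∈ U, ∀ j, lam w j ≤ lam u j + (∑ i, N i + 1) * ‖u - w‖ := by
    intro u hu w hw j
    obtain ⟨e, he⟩ := aux_basis _ (aux_herm H0 Hc hH0 hHc u) _ (hlam u hu).1 (hlam u hu).2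
    obtain ⟨f, hf⟩ := aux_basis _ (aux_herm H0 Hc hH0 hHc w) _ (hlam w hw).1 (hlam w hw).2
    refine aux_weyl e f _ _ _ _ (hlam u hu).1 (hlam w hw).1 he hf _ (fun x => ?_) j
    have : Matrix.toEuclideanLin (controlHam H0 Hc u) x - Matrix.toEuclideanLin (controlHam H0 Hc w) x
        = ∑ i, ((u i - w i : ℝ) : ℂ) • Matrix.toEuclideanLin (Hc i) x := by
      rw [← LinearMap.sub_apply, ← map_sub]
      have : controlHam H0 Hc u - controlHam H0 Hc w = ∑ i, ((u i - w i : ℝ) : ℂ) • Hc i := by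
        simp [controlHam, sub_smul]
      rw [this]
      simp
    rw [this]
    calc _ ≤ ∑ i, ‖((u i - w i : ℝ) : ℂ) • Matrix.toEuclideanLin (Hc i) x‖ := norm_sum_le _ _
      _ ≤ ∑ i, ‖u - w‖ * (N i * ‖x‖) := by
        refine Finset.sum_le_sum fun i _ => ?_
        rw [norm_smul]
        gcongr
        · rw [Complex.norm_real]
          exact PiLp.norm_apply_le (u - w) i
        · exact ContinuousLinearMap.le_opNorm (Matrix.toEuclideanLin (Hc i)).toContinuousLinearMap x
      _ = (∑ i, N i) * ‖u - w‖ * ‖x‖ := by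
        rw [← Finset.mul_sum, ← Finset.sum_mul]; ring
      _ ≤ _ := by gcongr; linarith
  intro u hu w hw j
  rw [abs_le]
  have h1 := key u hu w hw j
  have h2 := key w hw u hu j
  rw [norm_sub_rev] at h2
  constructor <;> linarith

end PartA
section PartB

open MeasureTheory Filter Topology Metric Set

theorem aux_null1 (g : ℝ → ℝ) (I : Set ℝ) (hI : IsPreconnected I) (hg : AnalyticOnNhd ℝ g I)
    (h0 : (0 : ℝ) ∈ I) (hg0 : g 0 ≠ 0) : volume {r | r ∈ I ∧ g r = 0} = 0 := by
  refine measure_null_of_locally_null _ fun r hr => ?_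
  rcases (hg r hr.1).eventually_eq_zero_or_eventually_ne_zero with h | h
  · exact absurd (hg.eqOn_zero_of_preconnected_of_eventuallyEq_zero hI hr.1 h h0) hg0
  · rw [eventually_nhdsWithin_iff] at h
    refine ⟨{r | r ∈ I ∧ g r = 0} ∩ {y | y ∈ ({r}ᶜ : Set ℝ) → g y ≠ 0},
      inter_mem_nhdsWithin _ h, ?_⟩
    refine measure_mono_null (t := {r}) (fun y hy => ?_) (by simp)
    by_contra hne
    exact hy.2 hne hy.1.2

theorem aux_null {m : ℕ} (f : EuclideanSpace ℝ (Fin m) → ℝ)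
    (x : EuclideanSpace ℝ (Fin m)) (ρ : ℝ) (hf : AnalyticOnNhd ℝ f (ball x ρ))
    (z : EuclideanSpace ℝ (Fin m)) (hz : z ∈ ball x ρ) (hfz : f z ≠ 0) :
    volume {y | y ∈ ball x ρ ∧ f y = 0} = 0 := by
  set Z : Set (EuclideanSpace ℝ (Fin m)) := {y | y ∈ ball x ρ ∧ f y = 0} with hZ
  have hZm : MeasurableSet Z := by
    have ho : IsOpen (ball x ρ ∩ f ⁻¹' {0}ᶜ) :=
      hf.continuousOn.isOpen_inter_preimage isOpen_ball isOpen_compl_singleton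
    have : Z = ball x ρ \ (ball x ρ ∩ f ⁻¹' {0}ᶜ) := by
      ext y; simp [hZ]
    rw [this]
    exact isOpen_ball.measurableSet.diff ho.measurableSet
  let S : Set (EuclideanSpace ℝ (Fin m)) := (fun w => z + w) ⁻¹' Z
  have hSm : MeasurableSet S := (measurable_const_add z) hZm
  have hSZ : volume S = volume Z := measure_preimage_add volume z Z
  rw [← hSZ]
  have h0S : (0 : EuclideanSpace ℝ (Fin m)) ∉ S := by
    simp [S, hZ, hfz]
  let T : Set (sphere (0 : EuclideanSpace ℝ (Fin m)) 1 × Ioi (0 : ℝ)) :=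
    {p | (p.2 : ℝ) • (p.1 : EuclideanSpace ℝ (Fin m)) ∈ S}
  have hTm : MeasurableSet T := by
    have : Measurable fun p : sphere (0 : EuclideanSpace ℝ (Fin m)) 1 × Ioi (0 : ℝ) =>
      (p.2 : ℝ) • (p.1 : EuclideanSpace ℝ (Fin m)) := by fun_prop
    exact this hSm
  have hmp := (volume : Measure (EuclideanSpace ℝ (Fin m))).measurePreserving_homeomorphUnitSphereProd
  have h1 := hmp.measure_preimage hTm.nullMeasurableSet
  have h2 : (homeomorphUnitSphereProd (EuclideanSpace ℝ (Fin m))) ⁻¹' T = Subtype.val ⁻¹' S := by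
    ext w
    have hw : ‖(w : EuclideanSpace ℝ (Fin m))‖ ≠ 0 := norm_ne_zero_iff.2 w.2
    simp [T, smul_smul, hw]
  rw [h2, comap_subtype_coe_apply (measurableSet_singleton _).compl, Subtype.image_preimage_coe,
    inter_eq_right.2 (fun y hy => by
      simp only [mem_compl_iff, mem_singleton_iff]; rintro rfl; exact h0S hy)] at h1
  rw [h1, Measure.measure_prod_null hTm]
  refine Eventually.of_forall fun s => ?_
  simp only [Pi.zero_apply]
  refine withDensity_absolutelyContinuous _ _ ?_
  rw [comap_subtype_coe_apply measurableSet_Ioi]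
  let I : Set ℝ := (fun r : ℝ => z + r • (s : EuclideanSpace ℝ (Fin m))) ⁻¹' ball x ρ
  have hI : Convex ℝ I := by
    have := (convex_ball x ρ).affine_preimage
      (AffineMap.lineMap (k := ℝ) z (z + (s : EuclideanSpace ℝ (Fin m))))
    have hIe : I = (AffineMap.lineMap (k := ℝ) z (z + (s : EuclideanSpace ℝ (Fin m)))) ⁻¹'
        ball x ρ := by
      ext r; simp [I, AffineMap.lineMap_apply, add_comm]
    rw [hIe]
    exact this
  refine measure_mono_null (t := {r | r ∈ I ∧ f (z + r • (s : EuclideanSpace ℝ (Fin m))) = 0}) ?_ 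
    (aux_null1 _ I hI.isPreconnected ?_ ?_ ?_)
  · rintro _ ⟨r, hr, rfl⟩
    exact hr
  · intro r hr
    have : AnalyticAt ℝ (fun r : ℝ => z + r • (s : EuclideanSpace ℝ (Fin m))) r := by fun_prop
    exact AnalyticAt.fun_comp (hf _ hr) this
  · simpa [I] using hz
  · simpa using hfz

theorem aux_punct {m : ℕ} (hm : 2 ≤ m) (x : EuclideanSpace ℝ (Fin m)) (ρ : ℝ) :
    IsPreconnected (ball x ρ \ {x}) := by
  have hr : 1 < Module.rank ℝ (EuclideanSpace ℝ (Fin m)) := by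
    rw [rank_eq_card_basis (EuclideanSpace.basisFun (Fin m) ℝ).toBasis]
    simp; omega
  have h1 := (isPreconnected_Ioo (a := (0:ℝ)) (b := ρ)).prod
    (isPreconnected_sphere hr (0 : EuclideanSpace ℝ (Fin m)) 1)
  have h2 := h1.image (fun p : ℝ × EuclideanSpace ℝ (Fin m) => x + p.1 • p.2) (by fun_prop)
  convert h2 using 1
  ext y
  constructor
  · rintro ⟨hy, hne⟩
    have hne' : ‖y - x‖ ≠ 0 := by simpa [sub_eq_zero] using hne
    refine ⟨(‖y - x‖, ‖y - x‖⁻¹ • (y - x)), ⟨⟨by positivity, ?_⟩, ?_⟩, ?_⟩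
    · simpa [dist_eq_norm] using hy
    · simp [norm_smul, hne']
    · simp [smul_smul, hne']
  · rintro ⟨⟨t, v⟩, ⟨⟨h1, h2⟩, h3⟩, rfl⟩
    simp only [mem_sphere_iff_norm, sub_zero] at h3
    have hv : v ≠ 0 := by rintro rfl; simp at h3
    simp at h1 h2
    refine ⟨?_, ?_⟩
    · simp [dist_eq_norm, norm_smul, h3, abs_of_pos h1, h2]
    · simp [h1.ne', hv]

end PartB
section PartC

open MeasureTheory Filter Topology Metric Set
open scoped ContDiff

theorem aux_cont {n m : ℕ} {U : Set (EuclideanSpace ℝ (Fin m))} (hU : IsOpen U)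
    {lam : EuclideanSpace ℝ (Fin m) → Fin n → ℝ} {L : ℝ}
    (hL : ∀ u ∈ U, ∀ w ∈ U, ∀ j, |lam u j - lam w j| ≤ L * ‖u - w‖)
    {u : EuclideanSpace ℝ (Fin m)} (hu : u ∈ U) (j : Fin n) :
    ContinuousAt (fun w => lam w j) u := by
  rw [ContinuousAt, tendsto_iff_dist_tendsto_zero]
  have h0 : Tendsto (fun w => L * ‖w - u‖) (𝓝 u) (𝓝 0) := by
    have : Continuous fun w : EuclideanSpace ℝ (Fin m) => L * ‖w - u‖ := by fun_prop
    simpa using this.tendsto u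
  refine squeeze_zero' (Eventually.of_forall fun _ => dist_nonneg) ?_ h0
  filter_upwards [hU.mem_nhds hu] with w hw
  exact hL w hw u hu j

theorem aux_analytic {n m : ℕ} (H0 : Matrix (Fin n) (Fin n) ℂ)
    (Hc : Fin m → Matrix (Fin n) (Fin n) ℂ)
    {U : Set (EuclideanSpace ℝ (Fin m))} (hU : IsOpen U)
    {lam : EuclideanSpace ℝ (Fin m) → Fin n → ℝ}
    (hlam : IsOrderedSpectrum H0 Hc U lam)
    {u : EuclideanSpace ℝ (Fin m)} (hu : u ∈ U) (l : Fin n)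
    (hc : ContinuousAt (fun w => lam w l) u)
    (hs : SimpleEigAt lam u l) : AnalyticAt ℝ (fun w => lam w l) u := by
  classical
  let ψ : EuclideanSpace ℝ (Fin m) × ℝ → ℝ := fun p =>
    (Matrix.det (Matrix.scalar (Fin n) (p.2 : ℂ) - controlHam H0 Hc p.1)).re
  have hψ : ∀ w ∈ U, ∀ t : ℝ, ψ (w, t) = ∏ j, (t - lam w j) := by
    intro w hw t
    have h1 := congrArg (Polynomial.eval (t : ℂ)) (hlam w hw).2
    rw [Matrix.eval_charpoly] at h1
    simp only [ψ, h1, Polynomial.eval_prod, Polynomial.eval_sub, Polynomial.eval_X,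
      Polynomial.eval_C]
    norm_cast
  have hcd : ContDiff ℝ ω ψ := by
    have : ContDiff ℝ ω fun p : EuclideanSpace ℝ (Fin m) × ℝ =>
        Matrix.det (Matrix.scalar (Fin n) (p.2 : ℂ) - controlHam H0 Hc p.1) := by
      simp only [Matrix.det_apply]
      refine ContDiff.sum fun σ _ => ?_
      refine ContDiff.const_smul _ ?_
      refine contDiff_prod fun i _ => ?_
      have he : ∀ i' i : Fin n, ContDiff ℝ ω fun p : EuclideanSpace ℝ (Fin m) × ℝ =>
          controlHam H0 Hc p.1 i' i := by
        intro i' i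
        simp only [controlHam, Matrix.add_apply, Matrix.sum_apply, Matrix.smul_apply, smul_eq_mul]
        refine contDiff_const.add (ContDiff.sum fun k _ => ContDiff.mul ?_ contDiff_const)
        exact Complex.ofRealCLM.contDiff.comp
          ((EuclideanSpace.proj (𝕜 := ℝ) k).contDiff.comp contDiff_fst)
      have hd : ContDiff ℝ ω fun p : EuclideanSpace ℝ (Fin m) × ℝ =>
          (Matrix.scalar (Fin n) (p.2 : ℂ)) (σ i) i := by
        by_cases h : σ i = i
        · simp only [Matrix.scalar_apply, h, Matrix.diagonal_apply_eq]
          exact Complex.ofRealCLM.contDiff.comp contDiff_snd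
        · simp only [Matrix.scalar_apply, Matrix.diagonal_apply_ne _ h]
          exact contDiff_const
      exact hd.sub (he _ _)
    exact Complex.reCLM.contDiff.comp this
  set p : EuclideanSpace ℝ (Fin m) × ℝ := (u, lam u l) with hp
  have hcda : ContDiffAt ℝ ω ψ p := hcd.contDiffAt
  have hder : fderiv ℝ ψ p (0, 1) ≠ 0 := by
    have h1 : HasFDerivAt ψ (fderiv ℝ ψ p) p := (hcda.differentiableAt (by simp)).hasFDerivAt
    have h2 : HasDerivAt (fun t : ℝ => (u, t)) ((0, 1) : EuclideanSpace ℝ (Fin m) × ℝ) (lam u l) :=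
      (hasDerivAt_const _ _).prodMk (hasDerivAt_id _)
    have h3 : HasDerivAt (fun t => ψ (u, t)) (fderiv ℝ ψ p (0, 1)) (lam u l) :=
      h1.comp_hasDerivAt (lam u l) h2
    have h4 : (fun t => ψ (u, t)) = fun t => (t - lam u l) * ∏ j ∈ Finset.univ.erase l, (t - lam u j) := by
      funext t
      rw [hψ u hu, Finset.mul_prod_erase _ (fun j => t - lam u j) (Finset.mem_univ l)]
    rw [h4] at h3
    have hq : DifferentiableAt ℝ (fun t : ℝ => ∏ j ∈ Finset.univ.erase l, (t - lam u j)) (lam u l) := by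
      fun_prop
    have h5 := ((hasDerivAt_id (lam u l)).sub_const (lam u l)).mul hq.hasDerivAt
    have h6 := h3.unique h5
    rw [h6]
    simp only [id, sub_self, zero_mul, add_zero, one_mul]
    refine Finset.prod_ne_zero_iff.2 fun j hj => ?_
    rw [sub_ne_zero]
    intro h
    exact (Finset.ne_of_mem_erase hj) (hs j h.symm)
  have hinv : (fderiv ℝ ψ p ∘L .inr ℝ (EuclideanSpace ℝ (Fin m)) ℝ).IsInvertible := by
    refine ⟨ContinuousLinearEquiv.unitsEquivAut ℝ (Units.mk0 _ hder), ?_⟩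
    ext
    simp
  have h1 := hcda.eventually_apply_eq_iff_implicitFunction (by simp) hinv
  have h2 : Tendsto (fun w => (w, lam w l)) (𝓝 u) (𝓝 p) := by
    rw [hp, nhds_prod_eq]
    exact tendsto_id.prodMk hc
  have h3 := h2.eventually h1
  have h0 : ∀ w ∈ U, ψ (w, lam w l) = 0 := fun w hw => by
    rw [hψ w hw]
    exact Finset.prod_eq_zero (Finset.mem_univ l) (by simp)
  have h4 : (fun w => lam w l) =ᶠ[𝓝 u] hcda.implicitFunction (by simp) hinv := by
    filter_upwards [h3, hU.mem_nhds hu] with w hw hwU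
    exact (hw.1 (by rw [h0 w hwU, hp, h0 u hu])).symm
  have h5 : ContDiffAt ℝ ω (hcda.implicitFunction (by simp) hinv) u :=
    hcda.contDiffAt_implicitFunction (by simp) hinv
  exact (h5.congr_of_eventuallyEq h4).analyticAt

theorem aux_isolated {n m : ℕ} {U : Set (EuclideanSpace ℝ (Fin m))} (hU : IsOpen U)
    {lam : EuclideanSpace ℝ (Fin m) → Fin n → ℝ} {L : ℝ}
    (hL : ∀ u ∈ U, ∀ w ∈ U, ∀ j, |lam u j - lam w j| ≤ L * ‖u - w‖)
    {u : EuclideanSpace ℝ (Fin m)} (hu : u ∈ U) (j k : Fin n)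
    (hcon : ConicalAt U lam j k u) :
    ∀ᶠ w in 𝓝 u, w ≠ u → lam w j ≠ lam w k := by
  obtain ⟨-, -, -, c, hc, hv⟩ := hcon
  have key : ∀ᶠ t in 𝓝 (0 : ℝ), ∀ v ∈ sphere (0 : EuclideanSpace ℝ (Fin m)) 1,
      0 < t → lam (u + t • v) j ≠ lam (u + t • v) k := by
    refine (isCompact_sphere _ _).eventually_forall_of_forall_eventually fun v hvs => ?_
    obtain ⟨ε, hε, hgap⟩ := hv v (by simpa using hvs)
    have e1 : ∀ᶠ z : ℝ × EuclideanSpace ℝ (Fin m) in 𝓝 (0, v), u + z.1 • z.2 ∈ U := by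
      have : ContinuousAt (fun z : ℝ × EuclideanSpace ℝ (Fin m) => u + z.1 • z.2) (0, v) := by
        fun_prop
      exact this.eventually_mem (hU.mem_nhds (by simpa using hu))
    have e2 : ∀ᶠ z : ℝ × EuclideanSpace ℝ (Fin m) in 𝓝 (0, v), u + z.1 • v ∈ U := by
      have : ContinuousAt (fun z : ℝ × EuclideanSpace ℝ (Fin m) => u + z.1 • v) (0, v) := by
        fun_prop
      exact this.eventually_mem (hU.mem_nhds (by simpa using hu))
    have e3 : ∀ᶠ z : ℝ × EuclideanSpace ℝ (Fin m) in 𝓝 (0, v), z.1 < ε :=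
      (continuous_fst.tendsto (0, v)).eventually (gt_mem_nhds hε)
    have e4 : ∀ᶠ z : ℝ × EuclideanSpace ℝ (Fin m) in 𝓝 (0, v), 2 * L * ‖v - z.2‖ < c := by
      have : ContinuousAt (fun z : ℝ × EuclideanSpace ℝ (Fin m) => 2 * L * ‖v - z.2‖) (0, v) := by
        fun_prop
      exact this.eventually (gt_mem_nhds (by simpa using hc))
    filter_upwards [e1, e2, e3, e4] with z h1 h2 h3 h4 hz heq
    have g := hgap z.1 hz h3
    have b1 := hL _ h2 _ h1 j
    have b2 := hL _ h2 _ h1 k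
    have hn : ‖(u + z.1 • v) - (u + z.1 • z.2)‖ = z.1 * ‖v - z.2‖ := by
      rw [add_sub_add_left_eq_sub, ← smul_sub, norm_smul, Real.norm_of_nonneg hz.le]
    rw [hn, abs_le] at b1 b2
    have : z.1 * (2 * L * ‖v - z.2‖) < z.1 * c := mul_lt_mul_of_pos_left h4 hz
    nlinarith [b1.1, b2.2]
  have hnt : Tendsto (fun w => ‖w - u‖) (𝓝 u) (𝓝 0) := by
    have : Continuous fun w : EuclideanSpace ℝ (Fin m) => ‖w - u‖ := by fun_prop
    simpa using this.tendsto u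
  filter_upwards [hnt.eventually key] with w hw hne
  have hne' : ‖w - u‖ ≠ 0 := by simpa [sub_eq_zero] using hne
  have := hw (‖w - u‖⁻¹ • (w - u)) (by simp [norm_smul, hne']) (by positivity)
  simpa [smul_smul, hne'] using this

theorem aux_trace {n m : ℕ} (H0 : Matrix (Fin n) (Fin n) ℂ)
    (Hc : Fin m → Matrix (Fin n) (Fin n) ℂ)
    {U : Set (EuclideanSpace ℝ (Fin m))}
    {lam : EuclideanSpace ℝ (Fin m) → Fin n → ℝ}
    (hlam : IsOrderedSpectrum H0 Hc U lam) :
    ∀ w ∈ U, ∑ l, lam w l = H0.trace.re + ∑ i, w i * (Hc i).trace.re := by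
  intro w hw
  have h1 : (controlHam H0 Hc w).trace = ∑ l, (lam w l : ℂ) := by
    rw [Matrix.trace_eq_sum_roots_charpoly, (hlam w hw).2, Polynomial.roots_prod _ _ (by
      simp [Finset.prod_ne_zero_iff, Polynomial.X_sub_C_ne_zero])]
    simp [Finset.sum]
  have h2 := congrArg Complex.re h1
  simp [controlHam, Matrix.trace_add, Matrix.trace_sum] at h2
  exact h2.symm

theorem aux_local {n m : ℕ} (hm : 2 ≤ m) (H0 : Matrix (Fin n) (Fin n) ℂ)
    (Hc : Fin m → Matrix (Fin n) (Fin n) ℂ)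
    {U : Set (EuclideanSpace ℝ (Fin m))} (hU : IsOpen U)
    {lam : EuclideanSpace ℝ (Fin m) → Fin n → ℝ}
    (hlam : IsOrderedSpectrum H0 Hc U lam) (j k : Fin n) (hjk : (j : ℕ) + 1 = k)
    {u : EuclideanSpace ℝ (Fin m)} (hcon : ConicalAt U lam j k u)
    (hd : ∀ l, l ≠ j → l ≠ k → DifferentiableAt ℝ (fun w => lam w l) u)
    (α : Fin n → ℝ) (hF : ∀ w ∈ U, ∑ l, α l * lam w l = 0) : α j = α k := by
  classical
  by_contra hne
  obtain ⟨hu, heq, -, c, hc, hv⟩ := hcon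
  have hjk' : j ≠ k := by rintro rfl; omega
  -- the gap
  have hdiff : DifferentiableAt ℝ (fun w => lam w k - lam w j) u := by
    let R : Finset (Fin n) := (Finset.univ.erase j).erase k
    have split : ∀ f : Fin n → ℝ, ∑ l, f l = f j + (f k + ∑ l ∈ R, f l) := by
      intro f
      rw [Finset.add_sum_erase _ _ (by simp [hjk'.symm]), Finset.add_sum_erase _ _ (by simp)]
    have hR : ∀ l ∈ R, DifferentiableAt ℝ (fun w => lam w l) u := by
      intro l hl
      simp [R] at hl
      exact hd l hl.2 hl.1
    let Q : EuclideanSpace ℝ (Fin m) → ℝ := fun w =>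
      (α j - α k)⁻¹ * (2 * ∑ l ∈ R, α l * lam w l + (α j + α k) *
        ((H0.trace.re + ∑ i, w i * (Hc i).trace.re) - ∑ l ∈ R, lam w l))
    have hQ : DifferentiableAt ℝ Q u := by
      have a1 : DifferentiableAt ℝ (fun w => ∑ l ∈ R, α l * lam w l) u :=
        DifferentiableAt.fun_sum fun l hl => (hR l hl).const_mul _
      have a2 : DifferentiableAt ℝ (fun w => ∑ l ∈ R, lam w l) u :=
        DifferentiableAt.fun_sum fun l hl => hR l hl
      have a3 : DifferentiableAt ℝ (fun w : EuclideanSpace ℝ (Fin m) =>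
          H0.trace.re + ∑ i, w i * (Hc i).trace.re) u := by fun_prop
      exact ((a1.const_mul 2).add ((a3.sub a2).const_mul _)).const_mul _
    refine hQ.congr_of_eventuallyEq ?_
    filter_upwards [hU.mem_nhds hu] with w hw
    have t := aux_trace H0 Hc hlam w hw
    have f := hF w hw
    rw [split] at t f
    have hne' : α j - α k ≠ 0 := sub_ne_zero.2 hne
    simp only [Q]
    rw [← t, eq_inv_mul_iff_mul_eq₀ hne']
    linear_combination (-2) * f
  let v : EuclideanSpace ℝ (Fin m) := EuclideanSpace.single ⟨0, by omega⟩ 1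
  have hvn : ‖v‖ = 1 := by simp [v]
  obtain ⟨ε, hε, hgap⟩ := hv v hvn
  have hmin : IsLocalMin (fun w => lam w k - lam w j) u := by
    filter_upwards [hU.mem_nhds hu] with w hw
    have := (hlam w hw).1 (show j ≤ k by rw [Fin.le_def]; omega)
    simp only [heq, sub_self, sub_nonneg]
    exact this
  have hf0 := hmin.fderiv_eq_zero
  have hline : HasDerivAt (fun t : ℝ => u + t • v) v 0 := by
    simpa using ((hasDerivAt_id (0:ℝ)).smul_const v).const_add u
  have hfd : HasFDerivAt (fun w => lam w k - lam w j) (0 : EuclideanSpace ℝ (Fin m) →L[ℝ] ℝ)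
      (u + (0:ℝ) • v) := by
    have := hdiff.hasFDerivAt
    rw [hf0] at this
    simpa using this
  have hder := hfd.comp_hasDerivAt (0:ℝ) hline
  have hlim := hder.tendsto_slope_zero_right
  have : c ≤ (0 : EuclideanSpace ℝ (Fin m) →L[ℝ] ℝ) v := by
    refine ge_of_tendsto hlim ?_
    filter_upwards [Ioo_mem_nhdsGT hε] with t ht
    have := hgap t ht.1 ht.2
    simp only [Function.comp, zero_add, zero_smul, add_zero, heq, sub_self, sub_zero, smul_eq_mul]
    rw [inv_mul_eq_div, le_div_iff₀ ht.1]
    exact this.le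
  simp at this
  linarith

end PartC
section PartD

open MeasureTheory Filter Topology Metric Set

theorem aux_main {n m : ℕ} (hm : 2 ≤ m)
    {U : Set (EuclideanSpace ℝ (Fin m))} (hU : IsOpen U) (hUconn : IsConnected U)
    (H0 : Matrix (Fin n) (Fin n) ℂ) (Hc : Fin m → Matrix (Fin n) (Fin n) ℂ)
    {lam : EuclideanSpace ℝ (Fin m) → Fin n → ℝ}
    (hlam : IsOrderedSpectrum H0 Hc U lam) {L : ℝ}
    (hL : ∀ u ∈ U, ∀ w ∈ U, ∀ j, |lam u j - lam w j| ≤ L * ‖u - w‖)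
    (hcc : ConicallyConnected U lam) (α : Fin n → ℚ)
    (hpos : volume {w | w ∈ U ∧ ∑ l, (α l : ℝ) * lam w l = 0} ≠ 0) :
    ∀ j k : Fin n, α j = α k := by
  let F : EuclideanSpace ℝ (Fin m) → ℝ := fun w => ∑ l, (α l : ℝ) * lam w l
  let good : EuclideanSpace ℝ (Fin m) → Prop := fun w =>
    ∀ j k : Fin n, (j : ℕ) + 1 = k → lam w j ≠ lam w k
  have hcont : ∀ u ∈ U, ∀ l, ContinuousAt (fun w => lam w l) u :=
    fun u hu l => aux_cont hU hL hu l
  have hiso : ∀ u ∈ U, ∀ᶠ w in 𝓝 u, w ≠ u → good w := by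
    intro u hu
    have : ∀ j k : Fin n, ∀ᶠ w in 𝓝 u, w ≠ u → (j : ℕ) + 1 = k → lam w j ≠ lam w k := by
      intro j k
      by_cases hjk : (j : ℕ) + 1 = k
      · by_cases heq : lam u j = lam u k
        · filter_upwards [aux_isolated hU hL hu j k (hcc.1 u hu j k hjk heq)] with w hw hne _
          exact hw hne
        · filter_upwards [((hcont u hu j).sub (hcont u hu k)).eventually_ne (sub_ne_zero.2 heq)] with w hw _ _
          exact sub_ne_zero.1 hw
      · exact Eventually.of_forall fun w _ h => absurd h hjk
    simp only [← eventually_all] at this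
    filter_upwards [this] with w hw hne j k
    exact hw j k hne
  have hsimple : ∀ w ∈ U, good w → ∀ l, SimpleEigAt lam w l := by
    intro w hw hg
    have hmono := (hlam w hw).1
    have hlt : ∀ a b : Fin n, a < b → lam w a < lam w b := by
      intro a b hab
      have hb : (a : ℕ) + 1 < n := by have := b.2; rw [Fin.lt_def] at hab; omega
      have h1 : lam w a ≤ lam w ⟨a + 1, hb⟩ := hmono (by rw [Fin.le_def]; simp)
      have h2 : lam w ⟨a + 1, hb⟩ ≤ lam w b := hmono (by
        rw [Fin.le_def]; rw [Fin.lt_def] at hab; simp; omega)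
      exact lt_of_lt_of_le (lt_of_le_of_ne h1 (hg a ⟨a + 1, hb⟩ rfl)) h2
    intro l l' h
    rcases lt_trichotomy l l' with h' | h' | h'
    · exact absurd h (hlt _ _ h').ne'
    · exact h'.symm
    · exact absurd h (hlt _ _ h').ne
  have hFan : ∀ w ∈ U, good w → AnalyticAt ℝ F w := by
    intro w hw hg
    refine Finset.analyticAt_fun_sum _ fun l _ => ?_
    exact analyticAt_const.mul
      (aux_analytic H0 Hc hU hlam hw l (hcont w hw l) (hsimple w hw hg l))
  have hFc : ∀ w ∈ U, ContinuousAt F w := by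
    intro w hw
    exact tendsto_finsetSum _ fun l _ => (hcont w hw l).tendsto.const_mul _
  have hball : ∀ u ∈ U, ∃ r > 0, ball u r ⊆ U ∧ ∀ w ∈ ball u r, w ≠ u → good w := by
    intro u hu
    have := (hiso u hu).and (hU.mem_nhds hu)
    obtain ⟨r, hr, h⟩ := Metric.eventually_nhds_iff_ball.1 this
    exact ⟨r, hr, fun w hw => (h w hw).2, fun w hw => (h w hw).1⟩
  -- the good set is open in U
  have hgopen : ∀ u ∈ U, good u → ∃ r > 0, ball u r ⊆ U ∧ ∀ w ∈ ball u r, good w := by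
    intro u hu hg
    obtain ⟨r, hr, h1, h2⟩ := hball u hu
    refine ⟨r, hr, h1, fun w hw => ?_⟩
    by_cases h : w = u
    · rw [h]; exact hg
    · exact h2 w hw h
  let G : Set (EuclideanSpace ℝ (Fin m)) := {w | ∀ᶠ y in 𝓝 w, F y = 0}
  have hGo : IsOpen G := isOpen_setOfPred_eventually_nhds
  have hGne : (U ∩ G).Nonempty := by
    by_contra hemp
    apply hpos
    refine measure_null_of_locally_null _ fun x hx => ?_
    obtain ⟨r, hr, h1, h2⟩ := hball x hx.1
    refine ⟨{w | w ∈ U ∧ F w = 0} ∩ ball x r, inter_mem_nhdsWithin _ (ball_mem_nhds x hr), ?_⟩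
    have hsub : {w | w ∈ U ∧ F w = 0} ∩ ball x r ⊆ {x} ∪ {w | (w ∈ U ∧ good w) ∧ F w = 0} := by
      rintro w ⟨hw, hwb⟩
      by_cases h : w = x
      · exact Or.inl h
      · exact Or.inr ⟨⟨hw.1, h2 w hwb h⟩, hw.2⟩
    refine measure_mono_null hsub (measure_union_null ?_ ?_)
    · have : Nonempty (Fin m) := ⟨⟨0, by omega⟩⟩
      simp
    · refine measure_null_of_locally_null _ fun y hy => ?_
      obtain ⟨s, hs, h3, h4⟩ := hgopen y hy.1.1 hy.1.2
      refine ⟨{w | (w ∈ U ∧ good w) ∧ F w = 0} ∩ ball y s,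
        inter_mem_nhdsWithin _ (ball_mem_nhds y hs), ?_⟩
      have : ∃ z ∈ ball y s, F z ≠ 0 := by
        by_contra hcon
        push Not at hcon
        exact hemp ⟨y, hy.1.1, by
          filter_upwards [ball_mem_nhds y hs] with z hz using hcon z hz⟩
      obtain ⟨z, hz, hFz⟩ := this
      refine measure_mono_null (t := {w | w ∈ ball y s ∧ F w = 0}) ?_
        (aux_null F y s (fun w hw => hFan w (h3 hw) (h4 w hw)) z hz hFz)
      rintro w ⟨hw, hwb⟩
      exact ⟨hwb, hw.2⟩
  have hUG : U ⊆ G := by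
    refine hUconn.isPreconnected.subset_of_closure_inter_subset hGo hGne ?_
    rintro x ⟨hxc, hxU⟩
    obtain ⟨r, hr, h1, h2⟩ := hball x hxU
    have hNe : (𝓝[≠] x).NeBot := by
      have : Nonempty (Fin m) := ⟨⟨0, by omega⟩⟩
      infer_instance
    obtain ⟨y, hy, hyG⟩ := mem_closure_iff.1 hxc _ isOpen_ball (mem_ball_self hr)
    -- a point of G in the punctured ball
    obtain ⟨z, hzb, hzG, hzx⟩ : ∃ z, z ∈ ball x r ∧ z ∈ G ∧ z ≠ x := by
      by_cases hyx : y = x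
      · subst hyx
        have : ∀ᶠ z in 𝓝[≠] y, (z ∈ ball y r ∧ z ∈ G) ∧ z ≠ y :=
          ((Filter.Eventually.and (ball_mem_nhds y hr) (hGo.mem_nhds hyG)).filter_mono
            nhdsWithin_le_nhds).and self_mem_nhdsWithin
        obtain ⟨z, hz⟩ := this.exists
        exact ⟨z, hz.1.1, hz.1.2, hz.2⟩
      · exact ⟨y, hy, hyG, hyx⟩
    have hz0 : EqOn F 0 (ball x r \ {x}) := by
      refine AnalyticOnNhd.eqOn_zero_of_preconnected_of_eventuallyEq_zero
        (fun w hw => hFan w (h1 hw.1) (h2 w hw.1 hw.2)) (aux_punct hm x r) ⟨hzb, hzx⟩ hzG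
    have hx0 : F x = 0 := by
      have t1 : Tendsto F (𝓝[≠] x) (𝓝 (F x)) := (hFc x hxU).tendsto.mono_left nhdsWithin_le_nhds
      have t2 : Tendsto F (𝓝[≠] x) (𝓝 0) := by
        refine tendsto_const_nhds.congr' ?_
        filter_upwards [self_mem_nhdsWithin, nhdsWithin_le_nhds (ball_mem_nhds x hr)] with w hw hwb
        exact (hz0 ⟨hwb, hw⟩).symm
      exact tendsto_nhds_unique t1 t2
    change ∀ᶠ y in 𝓝 x, F y = 0
    filter_upwards [ball_mem_nhds x hr] with w hw
    by_cases h : w = x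
    · rw [h]; exact hx0
    · exact hz0 ⟨hw, h⟩
  have hF0 : ∀ w ∈ U, ∑ l, (α l : ℝ) * lam w l = 0 := fun w hw => (hUG hw).self_of_nhds
  have hstep : ∀ j k : Fin n, (j : ℕ) + 1 = k → α j = α k := by
    intro j k hjk
    obtain ⟨u, hcon, hs⟩ := hcc.2 j k hjk
    have := aux_local hm H0 Hc hU hlam j k hjk hcon (fun l h1 h2 =>
      (aux_analytic H0 Hc hU hlam hcon.1 l (hcont u hcon.1 l) (hs l h1 h2)).differentiableAt)
      (fun l => (α l : ℝ)) hF0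
    exact_mod_cast this
  have h0 : ∀ (i : ℕ) (hi : i < n), α ⟨i, hi⟩ = α ⟨0, by omega⟩ := by
    intro i
    induction i with
    | zero => intro _; rfl
    | succ i ih =>
      intro hi
      rw [← ih (by omega)]
      exact (hstep ⟨i, by omega⟩ ⟨i + 1, hi⟩ rfl).symm
  intro j k
  exact (h0 j j.2).trans (h0 k k.2).symm

end PartD

/-- Lemma 2.10 of the paper. If the spectrum of the control-affine
Hamiltonian `H(·)` is conically connected, then there is a subset `Ū ⊆ U`, dense in `U`
and with complement of Lebesgue measure zero in `U`, such that any rational linear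
combination of the eigenvalues vanishing at some `ū ∈ Ū` has all coefficients equal. -/
theorem conically_connected_resonance_free {n m : ℕ} (hn : 2 ≤ n) (hm : 2 ≤ m)
    (U : Set (EuclideanSpace ℝ (Fin m))) (hUopen : IsOpen U) (hUconn : IsConnected U)
    (H0 : Matrix (Fin n) (Fin n) ℂ) (Hc : Fin m → Matrix (Fin n) (Fin n) ℂ)
    (hH0 : H0.IsHermitian) (hHc : ∀ i, (Hc i).IsHermitian)
    (lam : EuclideanSpace ℝ (Fin m) → Fin n → ℝ)
    (hlam : IsOrderedSpectrum H0 Hc U lam)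
    (hcc : ConicallyConnected U lam) :
    ∃ Ubar : Set (EuclideanSpace ℝ (Fin m)), Ubar ⊆ U ∧ U ⊆ closure Ubar ∧
      MeasureTheory.volume (U \ Ubar) = 0 ∧
      ∀ ubar ∈ Ubar, ∀ α : Fin n → ℚ,
        (∑ j, (α j : ℝ) * lam ubar j) = 0 → ∀ j k : Fin n, α j = α k := by
  classical
  obtain ⟨L, -, hL⟩ := aux_lip H0 Hc hH0 hHc U lam hlam
  have hnull : ∀ α : Fin n → ℚ, (¬ ∀ j k : Fin n, α j = α k) →
      MeasureTheory.volume {w | w ∈ U ∧ ∑ l, (α l : ℝ) * lam w l = 0} = 0 := by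
    intro α hα
    by_contra hpos
    exact hα (aux_main hm hUopen hUconn H0 Hc hlam hL hcc α hpos)
  have hvol : MeasureTheory.volume (U \ {u | u ∈ U ∧ ∀ α : Fin n → ℚ,
        (∑ j, (α j : ℝ) * lam u j) = 0 → ∀ j k : Fin n, α j = α k}) = 0 := by
    refine MeasureTheory.measure_mono_null (t := ⋃ α : {α : Fin n → ℚ // ¬ ∀ j k : Fin n, α j = α k},
      {w | w ∈ U ∧ ∑ l, (α.1 l : ℝ) * lam w l = 0}) ?_
      (MeasureTheory.measure_iUnion_null fun α => hnull α.1 α.2)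
    rintro w ⟨hw, hw2⟩
    simp only [Set.mem_ofPred_eq, not_and, not_forall] at hw2
    obtain ⟨α, h0, j, k, hne⟩ := hw2 hw
    refine Set.mem_iUnion.2 ⟨⟨α, fun h => hne (h j k)⟩, hw, h0⟩
  refine ⟨{u | u ∈ U ∧ ∀ α : Fin n → ℚ,
        (∑ j, (α j : ℝ) * lam u j) = 0 → ∀ j k : Fin n, α j = α k}, fun u hu => hu.1, ?_, hvol,
        fun u hu => hu.2⟩
  intro u hu
  by_contra hcl
  have ho : IsOpen (U ∩ (closure {u | u ∈ U ∧ ∀ α : Fin n → ℚ,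
        (∑ j, (α j : ℝ) * lam u j) = 0 → ∀ j k : Fin n, α j = α k})ᶜ) :=
    hUopen.inter isClosed_closure.isOpen_compl
  have h0 := (ho.measure_eq_zero_iff (μ := MeasureTheory.volume)).1 (by
    refine MeasureTheory.measure_mono_null ?_ hvol
    exact fun w hw => ⟨hw.1, fun h => hw.2 (subset_closure h)⟩)
  exact (Set.eq_empty_iff_forall_notMem.1 h0 u) ⟨hu, hcl⟩
end

section
/- Assume m ≥ 2, n ≥ 2, U ⊆ ℝ^m open and connected, H(u) = H0 + u1·H1 + ⋯ + um·Hm with H0,…,Hm Hermitian n×n complex matrices, and that the spectrum of H(·) is conically connected. If (α1,…,αn) ∈ ℚ^n satisfies α1·λ1(u) + ⋯ + αn·λn(u) = 0 for every u ∈ U, then α1 = α2 = ⋯ = αn. -/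
open scoped BigOperators

open Filter Topology in
theorem aux_cont_s1 {n : ℕ} (A B : Matrix (Fin n) (Fin n) ℂ) (l : ℝ → Fin n → ℝ)
    (h : ∀ᶠ t in 𝓝 (0:ℝ), Monotone (l t) ∧
      (A + (t:ℂ) • B).charpoly = ∏ j, (Polynomial.X - Polynomial.C ((l t j : ℂ)))) :
    Tendsto l (𝓝 0) (𝓝 (l 0)) := by
  have h0 := h.self_of_nhds
  -- determinant form
  have hdet : ∀ᶠ t : ℝ in 𝓝 (0:ℝ), ∀ x : ℝ,
      (Matrix.scalar (Fin n) (x:ℂ) - (A + (t:ℂ) • B)).det = ∏ j, ((x:ℂ) - (l t j : ℂ)) := by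
    filter_upwards [h] with t ht x
    rw [← Matrix.eval_charpoly, ht.2, Polynomial.eval_prod]
    simp
  -- bound
  have hb : ∃ R : ℝ, ∀ᶠ t in 𝓝 (0:ℝ), l t ∈ Set.pi Set.univ (fun _ : Fin n => Set.Icc (-R) R) := by
    letI : NormedRing (Matrix (Fin n) (Fin n) ℂ) := Matrix.linftyOpNormedRing
    letI : NormedAlgebra ℂ (Matrix (Fin n) (Fin n) ℂ) := Matrix.linftyOpNormedAlgebra
    have hc : ContinuousAt (fun t : ℝ => ‖A + (t:ℂ) • B‖ * ‖(1 : Matrix (Fin n) (Fin n) ℂ)‖) 0 := by fun_prop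
    refine ⟨‖A + ((0:ℝ):ℂ) • B‖ * ‖(1 : Matrix (Fin n) (Fin n) ℂ)‖ + 1, ?_⟩
    have := hc.eventually (gt_mem_nhds (lt_add_one _))
    filter_upwards [h, this] with t ht ht2
    rintro i -
    have hs : ((l t i : ℝ) : ℂ) ∈ spectrum ℂ (A + (t:ℂ) • B) := by
      rw [Matrix.mem_spectrum_iff_isRoot_charpoly, ht.2, Polynomial.IsRoot, Polynomial.eval_prod]
      exact Finset.prod_eq_zero (Finset.mem_univ i) (by simp)
    have h1 := spectrum.norm_le_norm_mul_of_mem hs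
    rw [Complex.norm_real, Real.norm_eq_abs] at h1
    have := abs_le.1 (h1.trans ht2.le)
    exact this
  obtain ⟨R, hR⟩ := hb
  rw [tendsto_iff_ultrafilter]
  intro g hg
  have hK : IsCompact (Set.pi Set.univ (fun _ : Fin n => Set.Icc (-R) R)) :=
    isCompact_univ_pi fun _ => isCompact_Icc
  obtain ⟨μ, -, hμ⟩ := hK.ultrafilter_le_nhds (g.map l) (by
    rw [le_principal_iff]; exact hg hR)
  have hμ' : Tendsto l g (𝓝 μ) := hμ
  have hμi : ∀ i, Tendsto (fun t => l t i) g (𝓝 (μ i)) := tendsto_pi_nhds.1 hμ'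
  have hmono : Monotone μ := by
    intro i j hij
    refine le_of_tendsto_of_tendsto (hμi i) (hμi j) ?_
    filter_upwards [hg h] with t ht
    exact ht.1 hij
  have heq : ∀ x : ℝ, ∏ j, ((x:ℂ) - (μ j : ℂ)) = ∏ j, ((x:ℂ) - (l 0 j : ℂ)) := by
    intro x
    have h1 : Tendsto (fun t => ∏ j, ((x:ℂ) - (l t j : ℂ))) g (𝓝 (∏ j, ((x:ℂ) - (μ j : ℂ)))) := by
      refine tendsto_finsetProd _ fun j _ => tendsto_const_nhds.sub ?_
      exact (Complex.continuous_ofReal.tendsto _).comp (hμi j)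
    have hc : Continuous (fun t : ℝ => (Matrix.scalar (Fin n) (x:ℂ) - (A + (t:ℂ) • B)).det) := by
      fun_prop
    have h2 := (hc.tendsto 0).mono_left hg
    have h3 : Tendsto (fun t => ∏ j, ((x:ℂ) - (l t j : ℂ))) g
      (𝓝 ((Matrix.scalar (Fin n) (x:ℂ) - (A + ((0:ℝ):ℂ) • B)).det)) := by
      refine h2.congr' ?_
      filter_upwards [hg hdet] with t ht
      exact ht x
    rw [tendsto_nhds_unique h1 h3, hdet.self_of_nhds x]
  have hpoly : (∏ j, (Polynomial.X - Polynomial.C (μ j))) =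
      ∏ j, (Polynomial.X - Polynomial.C (l 0 j)) := by
    apply Polynomial.funext
    intro x
    have := heq x
    simp only [Polynomial.eval_prod, Polynomial.eval_sub, Polynomial.eval_X, Polynomial.eval_C]
    exact_mod_cast this
  have hroots := congrArg Polynomial.roots hpoly
  have hr : ∀ f : Fin n → ℝ, (∏ j, (Polynomial.X - Polynomial.C (f j))).roots
      = (List.ofFn f : Multiset ℝ) := by
    intro f
    have : (∏ j, (Polynomial.X - Polynomial.C (f j)))
      = ((Finset.univ.val.map f).map fun a => Polynomial.X - Polynomial.C a).prod := by
      rw [Multiset.map_map]; rfl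
    rw [this, Polynomial.roots_multiset_prod_X_sub_C]
    simp [List.ofFn_eq_map, Fin.univ_def]
  rw [hr, hr, Multiset.coe_eq_coe] at hroots
  have : List.ofFn μ = List.ofFn (l 0) :=
    hroots.eq_of_sortedLE hmono.sortedLE_ofFn h0.1.sortedLE_ofFn
  rw [List.ofFn_injective this] at hμ'
  exact hμ'

open Filter Topology in
theorem aux_diff {n : ℕ} (A B : Matrix (Fin n) (Fin n) ℂ) (l : ℝ → Fin n → ℝ)
    (h : ∀ᶠ t in 𝓝 (0:ℝ), Monotone (l t) ∧
      (A + (t:ℂ) • B).charpoly = ∏ j, (Polynomial.X - Polynomial.C ((l t j : ℂ))))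
    (i : Fin n) (hi : ∀ i', l 0 i' = l 0 i → i' = i) :
    DifferentiableAt ℝ (fun t => l t i) 0 := by
  have hcont : Tendsto (fun t => l t i) (𝓝 0) (𝓝 (l 0 i)) :=
    tendsto_pi_nhds.1 (aux_cont_s1 A B l h) i
  have hdet : ∀ᶠ t : ℝ in 𝓝 (0:ℝ), ∀ x : ℝ,
      (Matrix.scalar (Fin n) (x:ℂ) - (A + (t:ℂ) • B)).det = ∏ j, ((x:ℂ) - (l t j : ℂ)) := by
    filter_upwards [h] with t ht x
    rw [← Matrix.eval_charpoly, ht.2, Polynomial.eval_prod]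
    simp
  set F : ℝ × ℝ → ℂ := fun p => (Matrix.scalar (Fin n) (p.2:ℂ) - (A + (p.1:ℂ) • B)).det with hF
  have hFs : ContDiff ℝ 1 F := by
    have e1 : ContDiff ℝ 1 (fun p : ℝ × ℝ => (p.1 : ℂ)) :=
      Complex.ofRealCLM.contDiff.comp contDiff_fst
    have e2 : ContDiff ℝ 1 (fun p : ℝ × ℝ => (p.2 : ℂ)) :=
      Complex.ofRealCLM.contDiff.comp contDiff_snd
    simp only [hF, Matrix.det_apply']
    refine ContDiff.sum fun σ _ => contDiff_const.mul (contDiff_prod fun a _ => ?_)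
    simp only [Matrix.sub_apply, Matrix.add_apply, Matrix.smul_apply, Matrix.scalar_apply,
      Matrix.diagonal_apply, smul_eq_mul]
    refine ContDiff.sub ?_ (contDiff_const.add (e1.mul contDiff_const))
    split_ifs
    · exact e2
    · exact contDiff_const
  have hst := (hFs.contDiffAt (x := ((0:ℝ), l 0 i))).hasStrictFDerivAt (by norm_num)
  set L := fderiv ℝ F ((0:ℝ), l 0 i)
  have hT : Tendsto (fun t : ℝ => (((t, l t i) : ℝ × ℝ), ((0, l t i) : ℝ × ℝ))) (𝓝 0)
      (𝓝 (((0:ℝ), l 0 i), ((0:ℝ), l 0 i))) :=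
    (tendsto_id.prodMk_nhds hcont).prodMk_nhds (tendsto_const_nhds.prodMk_nhds hcont)
  have ho := hst.isLittleO.comp_tendsto hT
  set q : ℝ → ℂ := fun t => ∏ j ∈ Finset.univ.erase i, ((l t i:ℂ) - (l 0 j : ℂ)) with hq
  have hqc : Tendsto q (𝓝 0) (𝓝 (q 0)) := by
    refine tendsto_finsetProd _ fun j _ => Tendsto.sub ?_ tendsto_const_nhds
    exact (Complex.continuous_ofReal.tendsto _).comp hcont
  have hq0 : q 0 ≠ 0 := by
    refine Finset.prod_ne_zero_iff.2 fun j hj => ?_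
    rw [sub_ne_zero]
    intro he
    exact (Finset.mem_erase.1 hj).1 (hi j (by exact_mod_cast he.symm))
  have hF1 : ∀ᶠ t in 𝓝 (0:ℝ), F (t, l t i) = 0 := by
    filter_upwards [hdet] with t ht
    simp only [hF]
    rw [ht]
    exact Finset.prod_eq_zero (Finset.mem_univ i) (by simp)
  have hF0 : ∀ t, F (0, l t i) = ((l t i:ℂ) - (l 0 i:ℂ)) * q t := by
    intro t
    have := hdet.self_of_nhds (l t i)
    simp only [hF, hq]
    rw [this]
    exact (Finset.mul_prod_erase Finset.univ (fun j => (l t i:ℂ) - (l 0 j : ℂ)) (Finset.mem_univ i)).symm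
  -- littleo for t
  have ho2 : (fun t : ℝ => ((l t i:ℂ) - (l 0 i:ℂ)) * q t + (t:ℂ) * L (1, 0)) =o[𝓝 0] (fun t : ℝ => t) := by
    have : (fun t : ℝ => ((l t i:ℂ) - (l 0 i:ℂ)) * q t + (t:ℂ) * L (1, 0)) =o[𝓝 0]
        (fun t : ℝ => ((t, (0:ℝ)) : ℝ × ℝ)) := by
      refine (ho.neg_left).congr' ?_ ?_
      · filter_upwards [hF1] with t ht
        have e : ((t, l t i) : ℝ × ℝ) - (0, l t i) = t • ((1:ℝ), (0:ℝ)) := by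
          ext <;> simp
        simp only [Function.comp, e, ht, hF0, map_smul, Complex.real_smul]
        ring
      · filter_upwards with t
        simp [Function.comp]
    refine this.trans_isBigO ?_
    refine Asymptotics.IsBigO.of_bound 1 (Eventually.of_forall fun t => ?_)
    simp [Prod.norm_def]
  have hlim : Tendsto (fun t : ℝ => ((t:ℂ))⁻¹ * ((l t i:ℂ) - (l 0 i:ℂ))) (𝓝[≠] 0)
      (𝓝 ((0 - L (1,0)) / q 0)) := by
    have h1 : Tendsto (fun t : ℝ => (((l t i:ℂ) - (l 0 i:ℂ)) * q t + (t:ℂ) * L (1, 0)) / (t:ℂ))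
        (𝓝[≠] 0) (𝓝 0) := by
      have : (fun t : ℝ => ((l t i:ℂ) - (l 0 i:ℂ)) * q t + (t:ℂ) * L (1, 0)) =o[𝓝 0]
          (fun t : ℝ => (t:ℂ)) := by
        refine ho2.trans_isBigO (Asymptotics.IsBigO.of_bound 1 (Eventually.of_forall fun t => ?_))
        simp
      exact this.tendsto_div_nhds_zero.mono_left nhdsWithin_le_nhds
    have hqw := hqc.mono_left (nhdsWithin_le_nhds (s := {(0:ℝ)}ᶜ))
    have h2 := (h1.sub_const (L (1,0))).div hqw hq0
    refine h2.congr' ?_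
    filter_upwards [self_mem_nhdsWithin, hqw.eventually_ne hq0] with t ht hqt
    have ht' : (t:ℂ) ≠ 0 := by exact_mod_cast ht
    simp only [Pi.div_apply]
    field_simp
    ring
  have hre := (Complex.continuous_re.tendsto _).comp hlim
  have : HasDerivAt (fun t => l t i) ((0 - L (1,0)) / q 0).re 0 := by
    rw [hasDerivAt_iff_tendsto_slope]
    refine hre.congr fun t => ?_
    simp only [Function.comp, slope, vsub_eq_sub, sub_zero, smul_eq_mul]
    rw [← Complex.ofReal_inv, ← Complex.ofReal_sub, ← Complex.ofReal_mul, Complex.ofReal_re]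
  exact this.differentiableAt

theorem aux_trace_s1 {n : ℕ} (M : Matrix (Fin n) (Fin n) ℂ) (f : Fin n → ℝ)
    (h : M.charpoly = ∏ j, (Polynomial.X - Polynomial.C ((f j : ℂ)))) :
    ∑ j, f j = M.trace.re := by
  rw [Matrix.trace_eq_sum_roots_charpoly, h]
  have : (∏ j, (Polynomial.X - Polynomial.C ((f j : ℂ))))
      = ((Finset.univ.val.map fun j => (f j : ℂ)).map
          fun a => Polynomial.X - Polynomial.C a).prod := by
    rw [Multiset.map_map]; rfl
  rw [this, Polynomial.roots_multiset_prod_X_sub_C]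
  change _ = (∑ j, (f j : ℂ)).re
  simp

open Filter Topology in
theorem aux_step {n m : ℕ} (hm : 2 ≤ m)
    (U : Set (EuclideanSpace ℝ (Fin m))) (hUopen : IsOpen U)
    (H0 : Matrix (Fin n) (Fin n) ℂ) (Hc : Fin m → Matrix (Fin n) (Fin n) ℂ)
    (lam : EuclideanSpace ℝ (Fin m) → Fin n → ℝ)
    (hlam : IsOrderedSpectrum H0 Hc U lam)
    (hcc : ConicallyConnected U lam)
    (α : Fin n → ℚ)
    (hα : ∀ u ∈ U, (∑ j, (α j : ℝ) * lam u j) = 0)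
    (j k : Fin n) (hjk : (j : ℕ) + 1 = (k : ℕ)) : α j = α k := by
  obtain ⟨u, ⟨huU, hujk, -, c, hc, hcon⟩, hsimp⟩ := hcc.2 j k hjk
  have hne : j ≠ k := by rintro rfl; omega
  set v : EuclideanSpace ℝ (Fin m) := EuclideanSpace.single ⟨0, by omega⟩ (1:ℝ) with hv
  have hv1 : ‖v‖ = 1 := by simp [hv]
  obtain ⟨ε, hε, hgap⟩ := hcon v hv1
  set A := controlHam H0 Hc u with hA
  set B : Matrix (Fin n) (Fin n) ℂ := ∑ i, (v i : ℂ) • Hc i with hB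
  set l : ℝ → Fin n → ℝ := fun t => lam (u + t • v) with hl
  have hAB : ∀ t : ℝ, controlHam H0 Hc (u + t • v) = A + (t:ℂ) • B := by
    intro t
    simp only [hA, hB, controlHam, Finset.smul_sum, add_assoc, ← Finset.sum_add_distrib, smul_smul,
      ← add_smul]
    simp
  have hU : ∀ᶠ t in 𝓝 (0:ℝ), u + t • v ∈ U := by
    have hcn : Continuous (fun t : ℝ => u + t • v) := by fun_prop
    exact hcn.continuousAt.eventually (hUopen.mem_nhds (by simpa using huU))
  have h : ∀ᶠ t in 𝓝 (0:ℝ), Monotone (l t) ∧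
      (A + (t:ℂ) • B).charpoly = ∏ j, (Polynomial.X - Polynomial.C ((l t j : ℂ))) := by
    filter_upwards [hU] with t ht
    rw [← hAB]
    exact hlam _ ht
  have hl0 : l 0 = lam u := by simp [hl]
  have hd : ∀ i, i ≠ j → i ≠ k → DifferentiableAt ℝ (fun t => l t i) 0 := by
    intro i h1 h2
    refine aux_diff A B l h i ?_
    rw [hl0]
    exact hsimp i h1 h2
  have hsplit : ∀ f : Fin n → ℝ, ∑ i, f i = f j + f k + ∑ i ∈ (Finset.univ.erase j).erase k, f i := by
    intro f
    rw [← Finset.add_sum_erase _ f (Finset.mem_univ j),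
      ← Finset.add_sum_erase _ f (Finset.mem_erase.2 ⟨hne.symm, Finset.mem_univ k⟩), add_assoc]
  by_contra hneα
  have hneα' : (α k : ℝ) - α j ≠ 0 := by
    rw [sub_ne_zero]; intro he; exact hneα (by exact_mod_cast he.symm)
  have hsumd : ∀ w : Fin n → ℝ, DifferentiableAt ℝ
      (fun t => ∑ i ∈ (Finset.univ.erase j).erase k, w i * l t i) 0 := by
    intro w
    refine DifferentiableAt.fun_sum fun i hi => ?_
    have h1 := Finset.mem_erase.1 hi
    exact (hd i (Finset.mem_erase.1 h1.2).1 h1.1).const_mul _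
  have hgd : DifferentiableAt ℝ (fun t => l t k - l t j) 0 := by
    have htr : DifferentiableAt ℝ (fun t : ℝ => (A.trace.re + t * B.trace.re)) 0 := by fun_prop
    have key : (fun t => l t k - l t j) =ᶠ[𝓝 0] fun t =>
        (((α k : ℝ) - α j)⁻¹ * (-2 * (∑ i ∈ (Finset.univ.erase j).erase k, (α i : ℝ) * l t i)
          - ((α k : ℝ) + α j) * ((A.trace.re + t * B.trace.re)
            - ∑ i ∈ (Finset.univ.erase j).erase k, (1:ℝ) * l t i))) := by
      filter_upwards [h, hU] with t ht htU
      have e1 := aux_trace_s1 _ _ ht.2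
      rw [hsplit] at e1
      simp only [Matrix.trace_add, Matrix.trace_smul, Complex.add_re, smul_eq_mul,
        Complex.re_ofReal_mul] at e1
      have e2 := hα _ htU
      rw [hsplit] at e2
      rw [eq_inv_mul_iff_mul_eq₀ hneα']
      simp only [one_mul]
      rw [← e1]
      have e3 : (α j : ℝ) * l t j + α k * l t k
        + ∑ i ∈ (Finset.univ.erase j).erase k, (α i : ℝ) * l t i = 0 := e2
      linear_combination 2 * e3
    refine DifferentiableAt.congr_of_eventuallyEq ?_ key
    exact (((hsumd fun i => (α i : ℝ)).const_mul _).sub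
      ((htr.sub (hsumd fun _ => 1)).const_mul _)).const_mul _
  have hmin : IsLocalMin (fun t => l t k - l t j) 0 := by
    filter_upwards [h] with t ht
    have h1 : l 0 k - l 0 j = 0 := by rw [hl0, hujk, sub_self]
    rw [h1]
    exact sub_nonneg.2 (ht.1 (by rw [Fin.le_def]; omega))
  have hder := hgd.hasDerivAt
  rw [hmin.deriv_eq_zero] at hder
  have hs := (hasDerivAt_iff_tendsto_slope.1 hder).mono_left
    (nhdsWithin_mono (0:ℝ) (fun x (hx : x ∈ Set.Ioi (0:ℝ)) => ne_of_gt hx))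
  have : c ≤ 0 := by
    refine ge_of_tendsto hs ?_
    filter_upwards [Ioo_mem_nhdsGT hε] with t ht
    have h1 : l 0 k - l 0 j = 0 := by rw [hl0, hujk, sub_self]
    have h2 : l t k - l t j > c * t := hgap t ht.1 ht.2
    simp only [slope, vsub_eq_sub, sub_zero, smul_eq_mul, h1]
    rw [le_inv_mul_iff₀ ht.1]
    linarith
  linarith

/-- If the spectrum of the control-affine Hamiltonian `H(·)` is
conically connected and a rational linear combination of the eigenvalues vanishes
identically on `U`, then all its coefficients are equal. -/
theorem conically_connected_identically_resonant {n m : ℕ} (hn : 2 ≤ n) (hm : 2 ≤ m)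
    (U : Set (EuclideanSpace ℝ (Fin m))) (hUopen : IsOpen U) (hUconn : IsConnected U)
    (H0 : Matrix (Fin n) (Fin n) ℂ) (Hc : Fin m → Matrix (Fin n) (Fin n) ℂ)
    (hH0 : H0.IsHermitian) (hHc : ∀ i, (Hc i).IsHermitian)
    (lam : EuclideanSpace ℝ (Fin m) → Fin n → ℝ)
    (hlam : IsOrderedSpectrum H0 Hc U lam)
    (hcc : ConicallyConnected U lam)
    (α : Fin n → ℚ)
    (hα : ∀ u ∈ U, (∑ j, (α j : ℝ) * lam u j) = 0) :
    ∀ j k : Fin n, α j = α k := by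
  have key := aux_step hm U hUopen H0 Hc lam hlam hcc α hα
  have hz : ∀ (a : ℕ) (ha : a < n), α ⟨a, ha⟩ = α ⟨0, by omega⟩ := by
    intro a
    induction a with
    | zero => intro _; rfl
    | succ a ih =>
      intro ha
      rw [← ih (by omega)]
      exact (key ⟨a, by omega⟩ ⟨a + 1, ha⟩ rfl).symm
  intro j k
  exact (hz j j.2).trans (hz k k.2).symm
end

section
/- Let p ≥ 1, n ≥ 1, and let φ : ℝ^p → GL(n,ℂ) be a continuous group homomorphism from the additive group ℝ^p to the group of invertible n×n complex matrices such that the operator norms of the matrices φ(x), x ∈ ℝ^p, are uniformly bounded, and such that the associated representation on ℂ^n is irreducible (the only complex linear subspaces of ℂ^n invariant under all φ(x) are {0} and ℂ^n). Then n = 1 and there exists ξ ∈ ℝ^p such that φ(x) = e^{i ξ·x} (as a 1×1 matrix) for every x ∈ ℝ^p. -/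
open scoped RealInnerProductSpace

lemma char_aux {p : ℕ} (χ : EuclideanSpace ℝ (Fin p) → ℂ) (hc : Continuous χ)
    (h0 : χ 0 = 1) (hm : ∀ x y, χ (x + y) = χ x * χ y) (C : ℝ) (hC : ∀ x, ‖χ x‖ ≤ C) :
    ∃ ξ : EuclideanSpace ℝ (Fin p), ∀ x, χ x = Complex.exp (Complex.I * (⟪ξ, x⟫ : ℝ)) := by
  have hpow : ∀ (x) (k : ℕ), χ (k • x) = χ x ^ k := by
    intro x k
    induction k with
    | zero => simp [h0]
    | succ k ih => rw [succ_nsmul, hm, ih, pow_succ]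
  have hle : ∀ x, ‖χ x‖ ≤ 1 := by
    intro x
    by_contra! h
    obtain ⟨k, hk⟩ := pow_unbounded_of_one_lt C h
    have := hC (k • x)
    rw [hpow, norm_pow] at this
    linarith
  have hn1 : ∀ x, ‖χ x‖ = 1 := by
    intro x
    have h1 : ‖χ x‖ * ‖χ (-x)‖ = 1 := by
      rw [← norm_mul, ← hm, add_neg_cancel, h0, norm_one]
    have := hle x
    have := hle (-x)
    nlinarith [norm_nonneg (χ x), norm_nonneg (χ (-x))]
  let f : C(EuclideanSpace ℝ (Fin p), Circle) :=
    ⟨fun x => ⟨χ x, by simp [Submonoid.unitSphere, hn1]⟩, by fun_prop⟩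
  have hf : ∀ x y, f (x + y) = f x * f y := fun x y => Subtype.ext (hm x y)
  have hf0 : f 0 = 1 := Subtype.ext h0
  obtain ⟨F, ⟨hF0, hF⟩, hu⟩ := Circle.isCoveringMap_exp.existsUnique_continuousMap_lifts f 0 0
    (by simp [hf0])
  have hFx : ∀ x, Circle.exp (F x) = f x := fun x => congrFun hF x
  have hadd : ∀ x y, F (x + y) = F x + F y := by
    intro x y
    have := hu ⟨fun x => F (x + y) - F y, by fun_prop⟩ ⟨by simp, by
      funext x
      simp [Circle.exp_sub, hFx, hf]⟩
    have := DFunLike.congr_fun this x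
    simp only [ContinuousMap.coe_mk] at this
    linarith
  let A : EuclideanSpace ℝ (Fin p) →+ ℝ := ⟨⟨F, hF0⟩, hadd⟩
  let L : EuclideanSpace ℝ (Fin p) →L[ℝ] ℝ := A.toRealLinearMap F.continuous
  refine ⟨(InnerProductSpace.toDual ℝ _).symm L, fun x => ?_⟩
  rw [InnerProductSpace.toDual_symm_apply]
  have : ((Circle.exp (F x) : Circle) : ℂ) = χ x := by rw [hFx]; rfl
  rw [← this, Circle.coe_exp, mul_comm]
  rfl

/-- Remark 4.3 of the paper. A bounded irreducible continuous
representation of the additive group `ℝ^p` on `ℂ^n` is one-dimensional (`n = 1`) and is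
a unitary character `x ↦ e^{i ξ·x}`. -/
theorem bounded_irreducible_rep_of_Rp_is_character {p n : ℕ} (hp : 1 ≤ p) (hn : 1 ≤ n)
    (φ : EuclideanSpace ℝ (Fin p) → Matrix.GeneralLinearGroup (Fin n) ℂ)
    (hcont : Continuous fun x => ((φ x : Matrix (Fin n) (Fin n) ℂ)))
    (hhom : ∀ x y : EuclideanSpace ℝ (Fin p), φ (x + y) = φ x * φ y)
    (hbdd : ∃ C : ℝ, ∀ x : EuclideanSpace ℝ (Fin p),
      ‖Matrix.toEuclideanCLM (𝕜 := ℂ) ((φ x : Matrix (Fin n) (Fin n) ℂ))‖ ≤ C)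
    (hirred : ∀ q : Submodule ℂ (EuclideanSpace ℂ (Fin n)),
      (∀ x : EuclideanSpace ℝ (Fin p), ∀ v ∈ q,
        Matrix.toEuclideanLin ((φ x : Matrix (Fin n) (Fin n) ℂ)) v ∈ q) →
      q = ⊥ ∨ q = ⊤) :
    n = 1 ∧ ∃ ξ : EuclideanSpace ℝ (Fin p), ∀ x : EuclideanSpace ℝ (Fin p),
      ∀ i j : Fin n, (φ x : Matrix (Fin n) (Fin n) ℂ) i j =
        Complex.exp (Complex.I * (⟪ξ, x⟫ : ℝ)) := by
  have : Nonempty (Fin n) := ⟨⟨0, hn⟩⟩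
  have hcomm : ∀ x y v, Matrix.toEuclideanLin (φ x : Matrix (Fin n) (Fin n) ℂ)
      (Matrix.toEuclideanLin (φ y : Matrix (Fin n) (Fin n) ℂ) v) =
      Matrix.toEuclideanLin (φ y : Matrix (Fin n) (Fin n) ℂ)
      (Matrix.toEuclideanLin (φ x : Matrix (Fin n) (Fin n) ℂ) v) := by
    intro x y v
    have h : (φ x * φ y : Matrix (Fin n) (Fin n) ℂ) = φ y * φ x := by
      rw [← Units.val_mul, ← Units.val_mul, ← hhom, ← hhom, add_comm]
    simp [Matrix.toEuclideanLin_apply, Matrix.mulVec_mulVec, h]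
  have hscal : ∀ x, ∃ c : ℂ, ∀ v,
      Matrix.toEuclideanLin (φ x : Matrix (Fin n) (Fin n) ℂ) v = c • v := by
    intro x
    obtain ⟨c, hc⟩ := Module.End.exists_eigenvalue
      (Matrix.toEuclideanLin (φ x : Matrix (Fin n) (Fin n) ℂ) :
        Module.End ℂ (EuclideanSpace ℂ (Fin n)))
    refine ⟨c, fun v => ?_⟩
    rcases hirred (Module.End.eigenspace
      (Matrix.toEuclideanLin (φ x : Matrix (Fin n) (Fin n) ℂ)) c) (by
        intro y v hv
        rw [Module.End.mem_eigenspace_iff] at hv ⊢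
        rw [hcomm, hv, map_smul]) with h | h
    · exact absurd h hc
    · exact Module.End.mem_eigenspace_iff.1 (h ▸ Submodule.mem_top)
  have hn1 : n = 1 := by
    obtain ⟨v, hv⟩ := exists_ne (0 : EuclideanSpace ℂ (Fin n))
    rcases hirred (ℂ ∙ v) (by
      intro x w hw
      obtain ⟨c, hc⟩ := hscal x
      rw [hc]
      exact Submodule.smul_mem _ _ hw) with h | h
    · exact absurd (Submodule.span_singleton_eq_bot.1 h) hv
    · have h1 := finrank_span_singleton (K := ℂ) hv
      rw [h, finrank_top, finrank_euclideanSpace_fin] at h1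
      exact h1
  refine ⟨hn1, ?_⟩
  subst hn1
  obtain ⟨C, hC⟩ := hbdd
  have hφ0 : φ 0 = 1 := by
    have := hhom 0 0
    rw [add_zero] at this
    exact left_eq_mul.1 this
  obtain ⟨ξ, hξ⟩ := char_aux (fun x => (φ x : Matrix (Fin 1) (Fin 1) ℂ) 0 0)
    (hcont.matrix_elem 0 0) (by simp [hφ0])
    (by intro x y; simp [hhom, Matrix.mul_apply]) C (by
      intro x
      have h := (Matrix.toEuclideanCLM (𝕜 := ℂ)
        (φ x : Matrix (Fin 1) (Fin 1) ℂ)).le_opNorm (EuclideanSpace.single 0 1)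
      have h2 := hC x
      have h3 : ‖Matrix.toEuclideanCLM (𝕜 := ℂ) (φ x : Matrix (Fin 1) (Fin 1) ℂ)
        (EuclideanSpace.single 0 1)‖ = ‖(φ x : Matrix (Fin 1) (Fin 1) ℂ) 0 0‖ := by
        rw [EuclideanSpace.norm_eq]
        simp
      rw [h3] at h
      simp at h
      exact h.trans h2)
  refine ⟨ξ, fun x i j => ?_⟩
  rw [Subsingleton.elim i 0, Subsingleton.elim j 0]
  exact hξ x
end

section
/- Let n ≥ 2 and let Ĝ be a dense subgroup of the special unitary group SU(n). Suppose there exist a nonempty open interval (a,b) ⊂ ℝ and a nonconstant real-analytic curve γ : (a,b) → SU(n) (analytic as a map into the n×n complex matrices) such that γ(t) ∈ Ĝ for every t ∈ (a,b). Then Ĝ = SU(n). -/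
attribute [local instance] Matrix.normedAddCommGroup Matrix.normedSpace

open Matrix in
theorem smith_unitary_inv {n : ℕ} (hn : 2 ≤ n) (V : Submodule ℝ (Matrix (Fin n) (Fin n) ℂ))
    (hV : ∀ g ∈ specialUnitaryGroup (Fin n) ℂ, ∀ v ∈ V, g * v * star g ∈ V)
    (U : Matrix (Fin n) (Fin n) ℂ) (hU : U ∈ unitaryGroup (Fin n) ℂ) (v) (hv : v ∈ V) :
    U * v * star U ∈ V := by
  have hd : ‖U.det‖ = 1 := by
    have := Matrix.det_of_mem_unitary hU
    exact CStarRing.norm_of_mem_unitary this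
  obtain ⟨z, hz⟩ := IsAlgClosed.exists_pow_nat_eq (U.det⁻¹) (show 0 < n by omega)
  have hz1 : ‖z‖ = 1 := by
    have : ‖z‖ ^ n = 1 := by rw [← norm_pow, hz, norm_inv, hd, inv_one]
    exact (pow_eq_one_iff_of_nonneg (norm_nonneg _) (by omega)).1 this
  have hzz : z * star z = 1 := by
    have := Complex.mul_conj z
    rw [Complex.normSq_eq_norm_sq, hz1] at this
    simpa using this
  have hd0 : U.det ≠ 0 := by intro h; simp [h] at hd
  have hmem : z • U ∈ specialUnitaryGroup (Fin n) ℂ := by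
    rw [mem_specialUnitaryGroup_iff]
    constructor
    · rw [mem_unitaryGroup_iff] at hU ⊢
      rw [star_smul, smul_mul_smul_comm, hU, hzz, one_smul]
    · rw [det_smul, Fintype.card_fin, hz, inv_mul_cancel₀ hd0]
  have := hV _ hmem v hv
  rwa [star_smul, smul_mul_assoc, smul_mul_smul_comm, hzz, one_smul] at this

open Matrix in
theorem smith_perm_conj {n : ℕ} (σ : Equiv.Perm (Fin n)) (d : Fin n → ℂ) :
    σ.permMatrix ℂ ∈ unitaryGroup (Fin n) ℂ ∧
    σ.permMatrix ℂ * diagonal d * star (σ.permMatrix ℂ) = diagonal (d ∘ σ) := by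
  have hs : star (σ.permMatrix ℂ) = (σ⁻¹).permMatrix ℂ := by
    rw [star_eq_conjTranspose, conjTranspose_permMatrix]
  constructor
  · rw [mem_unitaryGroup_iff, hs, ← permMatrix_mul]
    simp
  · rw [hs, PEquiv.toMatrix_toPEquiv_mul, PEquiv.mul_toMatrix_toPEquiv]
    ext i j
    simp [diagonal_apply, Equiv.Perm.inv_def]

/-- permutation-invariant subspaces -/
theorem smith_perm_sub {n : ℕ} (D : Submodule ℝ (Fin n → ℝ))
    (hD : ∀ σ : Equiv.Perm (Fin n), ∀ d ∈ D, d ∘ σ ∈ D) (d : Fin n → ℝ) (hd : d ∈ D)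
    (j k : Fin n) (hjk : d j ≠ d k) (m : Fin n → ℝ) (hm : ∑ i, m i = 0) : m ∈ D := by
  have hne : j ≠ k := fun h => hjk (by rw [h])
  have h1 : (Pi.single j 1 - Pi.single k 1 : Fin n → ℝ) ∈ D := by
    have h := D.smul_mem (d j - d k)⁻¹ (D.sub_mem hd (hD (Equiv.swap j k) d hd))
    convert h using 1
    have h0 : d j - d k ≠ 0 := sub_ne_zero.2 hjk
    ext i
    by_cases hij : i = j
    · subst hij; simp [hne, h0]
    by_cases hik : i = k
    · subst hik
      simp [hij, ]
      rw [← neg_sub (d j), mul_neg, inv_mul_cancel₀ h0]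
    · simp [hij, hik, Equiv.swap_apply_of_ne_of_ne]
  have h2 : ∀ i, (Pi.single i 1 - Pi.single k 1 : Fin n → ℝ) ∈ D := by
    intro i
    by_cases hik : i = k
    · subst hik; simp
    have h := hD (Equiv.swap i j) _ h1
    convert h using 1
    ext l
    simp only [Pi.sub_apply, Function.comp, Pi.single_apply]
    have e1 : (Equiv.swap i j l = j) ↔ l = i := by
      rw [Equiv.swap_apply_eq_iff]; simp
    have e2 : (Equiv.swap i j l = k) ↔ l = k := by
      rw [Equiv.swap_apply_eq_iff, Equiv.swap_apply_of_ne_of_ne (Ne.symm hik) hne.symm]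
    simp [e1, e2]
  have h3 : m = ∑ i, m i • (Pi.single i 1 - Pi.single k 1 : Fin n → ℝ) := by
    simp only [smul_sub, Finset.sum_sub_distrib, ← Finset.sum_smul, hm, zero_smul, sub_zero]
    ext l
    simp [Finset.sum_apply, Pi.single_apply]
  rw [h3]
  exact D.sum_mem fun i _ => D.smul_mem _ (h2 i)

open Matrix in
theorem smith_diag {n : ℕ} (Y : Matrix (Fin n) (Fin n) ℂ) (hY : star Y = -Y) :
    ∃ U ∈ unitaryGroup (Fin n) ℂ, ∃ d : Fin n → ℝ,
      Y = U * diagonal (fun i => Complex.I * (d i : ℂ)) * star U := by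
  have hH : ((-Complex.I) • Y).IsHermitian := by
    rw [IsHermitian, ← star_eq_conjTranspose, star_smul, hY]; simp
  refine ⟨hH.eigenvectorUnitary, hH.eigenvectorUnitary.2, hH.eigenvalues, ?_⟩
  have h := hH.spectral_theorem
  rw [Unitary.conjStarAlgAut_apply] at h
  have h2 : Y = Complex.I • ((-Complex.I) • Y) := by
    rw [smul_smul]; simp
  refine h2.trans ?_
  conv_lhs => rw [h]
  have : (diagonal (fun i => Complex.I * (hH.eigenvalues i : ℂ)) : Matrix (Fin n) (Fin n) ℂ) = Complex.I • diagonal (RCLike.ofReal ∘ hH.eigenvalues) := by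
    ext i j
    simp [diagonal_apply]
  rw [this]
  simp

open Matrix in
theorem smith_irred {n : ℕ} (hn : 2 ≤ n) (V : Submodule ℝ (Matrix (Fin n) (Fin n) ℂ))
    (hV : ∀ g ∈ specialUnitaryGroup (Fin n) ℂ, ∀ v ∈ V, g * v * star g ∈ V)
    (X : Matrix (Fin n) (Fin n) ℂ) (hX : X ∈ V) (hXs : star X = -X)
    (hXn : ∀ r : ℝ, X ≠ (Complex.I * r) • (1 : Matrix (Fin n) (Fin n) ℂ))
    (Y : Matrix (Fin n) (Fin n) ℂ) (hYs : star Y = -Y) (hYt : Y.trace = 0) : Y ∈ V := by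
  have hV' := smith_unitary_inv hn V hV
  let T : (Fin n → ℝ) →ₗ[ℝ] Matrix (Fin n) (Fin n) ℂ :=
    { toFun := fun d => diagonal (fun i => Complex.I * (d i : ℂ))
      map_add' := by intro x y; ext i j; by_cases h : i = j <;> simp [h, mul_add]
      map_smul' := by
        intro c x; ext i j; by_cases h : i = j <;> simp [h, mul_left_comm] }
  have hT : ∀ d, T d = diagonal (fun i => Complex.I * (d i : ℂ)) := fun d => rfl
  obtain ⟨U, hU, d, hd⟩ := smith_diag X hXs
  obtain ⟨W, hW, m, hm⟩ := smith_diag Y hYs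
  have hUU := hU
  have hWW := hW
  rw [mem_unitaryGroup_iff'] at hU hW
  have hdV : d ∈ V.comap T := by
    rw [Submodule.mem_comap, hT]
    have h := hV' (star U) (Unitary.star_mem hUU) X hX
    rw [hd] at h
    convert h using 1
    simp only [star_star, ← mul_assoc, hU, one_mul]
    rw [mul_assoc, hU, mul_one]
  have hjk : ∃ j k, d j ≠ d k := by
    by_contra! hc
    refine hXn (d ⟨0, by omega⟩) ?_
    rw [hd]
    have : (fun i => Complex.I * (d i : ℂ)) = fun _ => Complex.I * (d ⟨0, by omega⟩ : ℂ) := by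
      ext i; rw [hc i ⟨0, by omega⟩]
    rw [this]
    rw [← smul_one_eq_diagonal, mul_smul_comm, smul_mul_assoc, mul_one, mem_unitaryGroup_iff.1 hUU]
  obtain ⟨j, k, hjk⟩ := hjk
  have hsum : ∑ i, m i = 0 := by
    rw [hm, trace_mul_comm, ← mul_assoc, hW, one_mul, trace_diagonal, ← Finset.mul_sum] at hYt
    have := (mul_eq_zero.1 hYt).resolve_left Complex.I_ne_zero
    exact_mod_cast this
  have hmV : m ∈ V.comap T := by
    refine smith_perm_sub _ ?_ d hdV j k hjk m hsum
    intro σ e he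
    rw [Submodule.mem_comap, hT] at he ⊢
    obtain ⟨h1, h2⟩ := smith_perm_conj σ (fun i => Complex.I * (e i : ℂ))
    have := hV' _ h1 _ he
    rw [h2] at this
    exact this
  rw [hm]
  exact hV' W hWW _ hmV

theorem smith_mul_deriv {n : ℕ} {E : Type*} [NormedAddCommGroup E] [NormedSpace ℝ E]
    {f g : E → Matrix (Fin n) (Fin n) ℂ} {f' g' : E →L[ℝ] Matrix (Fin n) (Fin n) ℂ} {x : E}
    (hf : HasStrictFDerivAt f f' x) (hg : HasStrictFDerivAt g g' x) :
    ∃ L : E →L[ℝ] Matrix (Fin n) (Fin n) ℂ, HasStrictFDerivAt (fun e => f e * g e) L x ∧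
      ∀ v, L v = f x * g' v + f' v * g x := by
  let B : Matrix (Fin n) (Fin n) ℂ →L[ℝ] Matrix (Fin n) (Fin n) ℂ →L[ℝ] Matrix (Fin n) (Fin n) ℂ :=
    LinearMap.toContinuousLinearMap
      (LinearMap.toContinuousLinearMap.toLinearMap ∘ₗ
        (LinearMap.mul ℝ (Matrix (Fin n) (Fin n) ℂ)))
  have hB : ∀ a b, B a b = a * b := fun a b => rfl
  refine ⟨_, B.hasStrictFDerivAt_of_bilinear hf hg, ?_⟩
  intro v
  rfl

/-- star as a real continuous linear map -/
noncomputable def smithStar (n : ℕ) :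
    Matrix (Fin n) (Fin n) ℂ →L[ℝ] Matrix (Fin n) (Fin n) ℂ :=
  LinearMap.toContinuousLinearMap
    { toFun := fun Y => star Y
      map_add' := fun x y => star_add x y
      map_smul' := fun c x => by simp }

theorem smithStar_apply (n : ℕ) (Y) : smithStar n Y = star Y := rfl

open Matrix in
theorem smith_rigid {n : ℕ} (Y : Matrix (Fin n) (Fin n) ℂ) (r : ℝ)
    (hr : |r| < 1)
    (hunit : IsUnit ((1 : Matrix (Fin n) (Fin n) ℂ) + (Y + star Y) + ((Real.sqrt (1 - r ^ 2) : ℝ) : ℂ) • 1))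
    (hroot : ((Real.sqrt (1 - r ^ 2) : ℝ) + Complex.I * r : ℂ) ^ n = 1 →
      ((Real.sqrt (1 - r ^ 2) : ℝ) + Complex.I * r : ℂ) = 1)
    (hu : 1 + (Y + star Y) + (Complex.I * r) • (1 : Matrix (Fin n) (Fin n) ℂ) ∈
      specialUnitaryGroup (Fin n) ℂ) :
    1 + (Y + star Y) + (Complex.I * r) • (1 : Matrix (Fin n) (Fin n) ℂ) = 1 := by
  set A : Matrix (Fin n) (Fin n) ℂ := 1 + (Y + star Y) with hA
  set c : ℝ := Real.sqrt (1 - r ^ 2) with hc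
  have hc2 : c ^ 2 = 1 - r ^ 2 := by
    rw [hc, Real.sq_sqrt]
    nlinarith [abs_lt.1 hr]
  have hAs : star A = A := by simp [hA, add_comm]
  clear_value A
  rw [mem_specialUnitaryGroup_iff, mem_unitaryGroup_iff] at hu
  obtain ⟨hu1, hu2⟩ := hu
  have h1 : star (A + (Complex.I * r) • (1 : Matrix (Fin n) (Fin n) ℂ)) = A - (Complex.I * r) • 1 := by
    rw [star_add, hAs, star_smul, star_one]
    simp [sub_eq_add_neg]
  rw [h1] at hu1
  have h2 : (A + (Complex.I * r) • (1 : Matrix (Fin n) (Fin n) ℂ)) * (A - (Complex.I * r) • 1)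
      = A * A + ((r : ℂ) ^ 2) • 1 := by
    rw [add_mul, mul_sub, mul_sub]
    simp only [smul_mul_assoc, mul_smul_comm, one_mul, mul_one, smul_smul]
    have : Complex.I * r * (Complex.I * r) = -(r : ℂ) ^ 2 := by
      ring_nf; simp
    rw [this, neg_smul]
    abel
  rw [h2] at hu1
  have h3 : (A - (c : ℂ) • 1) * (A + (c : ℂ) • 1) = 0 := by
    rw [sub_mul, mul_add, mul_add]
    simp only [smul_mul_assoc, mul_smul_comm, one_mul, mul_one, smul_smul]
    have e : (c : ℂ) * c = 1 - (r : ℂ) ^ 2 := by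
      rw [← sq]; exact_mod_cast hc2
    have e2 : A * A = (1 : Matrix (Fin n) (Fin n) ℂ) - ((r : ℂ) ^ 2) • 1 := eq_sub_of_add_eq hu1
    rw [e, sub_smul, one_smul, e2]
    abel
  have h4 : A - (c : ℂ) • 1 = 0 := (hunit.mul_left_eq_zero).1 h3
  have h5 : A = (c : ℂ) • 1 := sub_eq_zero.1 h4
  rw [h5, ← add_smul] at hu2 ⊢
  rw [det_smul, det_one, mul_one, Fintype.card_fin] at hu2
  rw [hroot hu2, one_smul]

open Matrix Filter Topology in
theorem smith_local {n : ℕ} (hn : 2 ≤ n) (Ghat : Set (Matrix (Fin n) (Fin n) ℂ))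
    (hsub : Ghat ⊆ (specialUnitaryGroup (Fin n) ℂ : Set (Matrix (Fin n) (Fin n) ℂ)))
    {E : Type} [NormedAddCommGroup E] [NormedSpace ℝ E] [CompleteSpace E]
    (F : E → Matrix (Fin n) (Fin n) ℂ) (F' : E →L[ℝ] Matrix (Fin n) (Fin n) ℂ)
    (hF : HasStrictFDerivAt F F' 0) (hF0 : F 0 = 1) (hFG : ∀ᶠ e in 𝓝 (0 : E), F e ∈ Ghat)
    (hrange : ∀ Y : Matrix (Fin n) (Fin n) ℂ, star Y = -Y → Y.trace = 0 → ∃ e, F' e = Y) :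
    ∀ᶠ g in 𝓝 (1 : Matrix (Fin n) (Fin n) ℂ),
      g ∈ specialUnitaryGroup (Fin n) ℂ → g ∈ Ghat := by
  let S : E × (Matrix (Fin n) (Fin n) ℂ) × ℝ →L[ℝ] Matrix (Fin n) (Fin n) ℂ :=
    (ContinuousLinearMap.id ℝ _ + smithStar n) ∘L
      (ContinuousLinearMap.fst ℝ (Matrix (Fin n) (Fin n) ℂ) ℝ ∘L ContinuousLinearMap.snd ℝ E _) +
    (ContinuousLinearMap.toSpanSingleton ℝ (Complex.I • (1 : Matrix (Fin n) (Fin n) ℂ))) ∘L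
      (ContinuousLinearMap.snd ℝ (Matrix (Fin n) (Fin n) ℂ) ℝ ∘L ContinuousLinearMap.snd ℝ E _)
  have hS : ∀ p, S p = (p.2.1 + star p.2.1) + (Complex.I * p.2.2) • (1 : Matrix (Fin n) (Fin n) ℂ) := by
    intro p
    simp only [S, _root_.add_apply, ContinuousLinearMap.comp_apply,
      ContinuousLinearMap.coe_snd', ContinuousLinearMap.coe_fst', ContinuousLinearMap.id_apply,
      ContinuousLinearMap.toSpanSingleton_apply, smithStar_apply]
    congr 1
    ext i j
    simp [Matrix.one_apply]
    split_ifs <;> simp [mul_comm]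
  have hf1 : HasStrictFDerivAt (fun p : E × (Matrix (Fin n) (Fin n) ℂ) × ℝ => F p.1)
      (F' ∘L ContinuousLinearMap.fst ℝ E _) 0 := by
    refine HasStrictFDerivAt.comp (g := F) (f := Prod.fst) _ hF hasStrictFDerivAt_fst
  have hf2 : HasStrictFDerivAt (fun p : E × (Matrix (Fin n) (Fin n) ℂ) × ℝ => 1 + S p) S 0 :=
    S.hasStrictFDerivAt.const_add 1
  obtain ⟨L, hL, hLv⟩ := smith_mul_deriv hf1 hf2
  have hS0 : S 0 = 0 := by rw [hS]; simp
  have hLv' : ∀ e Y q, L (e, Y, q) =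
      ((Y + star Y) + (Complex.I * (q : ℝ)) • (1 : Matrix (Fin n) (Fin n) ℂ)) + F' e := by
    intro e Y q
    refine (hLv (e, Y, q)).trans ?_
    change F 0 * S (e, Y, q) + F' e * (1 + S 0) = _
    rw [hS0, hF0, hS, one_mul, add_zero, mul_one]
  have hsurj : L.toLinearMap.range = ⊤ := by
    rw [LinearMap.range_eq_top]
    intro Z
    have hn0 : (n : ℂ) ≠ 0 := by exact_mod_cast (by omega : n ≠ 0)
    obtain ⟨K, hK⟩ : ∃ K : Matrix (Fin n) (Fin n) ℂ, K = (1/2 : ℝ) • (Z - star Z) := ⟨_, rfl⟩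
    have hKs : star K = -K := by
      simp [hK, ← smul_neg]
    have htr : K.trace = Complex.I * (K.trace.im : ℂ) := by
      have h : star K.trace = -K.trace := by
        rw [← trace_neg, ← hKs, star_eq_conjTranspose, trace_conjTranspose]
      have hre : K.trace.re = 0 := by
        have := congrArg Complex.re h
        simp at this
        linarith
      apply Complex.ext <;> simp [hre]
    set q : ℝ := K.trace.im / n with hq
    have hq' : K.trace = Complex.I * q * n := by
      rw [htr, hq]; push_cast; field_simp
    obtain ⟨e, he⟩ := hrange (K - (Complex.I * q) • 1) (by
      rw [star_sub, hKs, star_smul, star_one]; simp; abel) (by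
      rw [trace_sub, trace_smul, trace_one, hq', Fintype.card_fin]; simp)
    refine ⟨(e, (1/4 : ℝ) • (Z + star Z), q), ?_⟩
    refine (hLv' _ _ _).trans ?_
    rw [he]
    rw [hK, star_smul, star_add, star_star]
    simp only [star_trivial]
    module
  have hmap : Filter.map (fun p => F p.1 * (1 + S p)) (𝓝 0) = 𝓝 (1 : Matrix (Fin n) (Fin n) ℂ) := by
    have e0 : F (0 : E × (Matrix (Fin n) (Fin n) ℂ) × ℝ).1 * (1 + S 0) = 1 := by
      rw [hS0, Prod.fst_zero, hF0, add_zero, mul_one]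
    exact (hL.map_nhds_eq_of_surj hsurj).trans (congrArg _ e0)
  rw [← hmap, eventually_map]
  have e1 : ∀ᶠ p in 𝓝 (0 : E × (Matrix (Fin n) (Fin n) ℂ) × ℝ), F p.1 ∈ Ghat :=
    (continuous_fst.tendsto' (0 : E × (Matrix (Fin n) (Fin n) ℂ) × ℝ) 0 rfl).eventually hFG
  have e2 : ∀ᶠ p in 𝓝 (0 : E × (Matrix (Fin n) (Fin n) ℂ) × ℝ), |p.2.2| < 1 := by
    have hcont : Continuous fun p : E × (Matrix (Fin n) (Fin n) ℂ) × ℝ => |p.2.2| := by fun_prop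
    exact (hcont.tendsto' 0 0 (by simp)).eventually (gt_mem_nhds one_pos)
  have e3 : ∀ᶠ p in 𝓝 (0 : E × (Matrix (Fin n) (Fin n) ℂ) × ℝ),
      IsUnit ((1 : Matrix (Fin n) (Fin n) ℂ) + (p.2.1 + star p.2.1) +
        ((Real.sqrt (1 - p.2.2 ^ 2) : ℝ) : ℂ) • 1) := by
    have hcont : Continuous fun p : E × (Matrix (Fin n) (Fin n) ℂ) × ℝ =>
      ((1 : Matrix (Fin n) (Fin n) ℂ) + (p.2.1 + star p.2.1) +
        ((Real.sqrt (1 - p.2.2 ^ 2) : ℝ) : ℂ) • (1 : Matrix (Fin n) (Fin n) ℂ)).det := by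
      apply Continuous.matrix_det
      refine Continuous.add (by fun_prop) ?_
      have hq : Continuous fun p : E × (Matrix (Fin n) (Fin n) ℂ) × ℝ =>
        ((Real.sqrt (1 - p.2.2 ^ 2) : ℝ) : ℂ) := by fun_prop
      exact hq.smul continuous_const
    have h0 : ((1 : Matrix (Fin n) (Fin n) ℂ) + 1).det ≠ 0 := by
      rw [← two_smul ℂ (1 : Matrix (Fin n) (Fin n) ℂ), det_smul]; simp
    have := (hcont.tendsto' 0 ((1 : Matrix (Fin n) (Fin n) ℂ) + 1).det (by simp)).eventually
      (isOpen_ne.mem_nhds h0)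
    filter_upwards [this] with p hp
    rw [isUnit_iff_isUnit_det]
    exact isUnit_iff_ne_zero.2 hp
  have e4 : ∀ᶠ p in 𝓝 (0 : E × (Matrix (Fin n) (Fin n) ℂ) × ℝ),
      ((Real.sqrt (1 - p.2.2 ^ 2) : ℝ) + Complex.I * p.2.2 : ℂ) ^ n = 1 →
      ((Real.sqrt (1 - p.2.2 ^ 2) : ℝ) + Complex.I * p.2.2 : ℂ) = 1 := by
    have hcont : Continuous fun p : E × (Matrix (Fin n) (Fin n) ℂ) × ℝ =>
      ((Real.sqrt (1 - p.2.2 ^ 2) : ℝ) + Complex.I * p.2.2 : ℂ) := by fun_prop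
    have hfin : ({z : ℂ | z ^ n = 1} \ {1}).Finite := by
      refine Set.Finite.subset (Polynomial.nthRoots n (1 : ℂ)).toFinset.finite_toSet ?_
      intro z hz
      simp only [Finset.mem_coe, Multiset.mem_toFinset]
      rw [Polynomial.mem_nthRoots (by omega)]
      exact hz.1
    have hnb : ({z : ℂ | z ^ n = 1} \ {1})ᶜ ∈ 𝓝 (1 : ℂ) :=
      hfin.isClosed.isOpen_compl.mem_nhds (by simp)
    have := (hcont.tendsto' 0 1 (by simp)).eventually hnb
    filter_upwards [this] with p hp h1
    by_contra h2
    exact hp ⟨h1, h2⟩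
  filter_upwards [e1, e2, e3, e4] with p h1 h2 h3 h4 hg
  have hFs := hsub h1
  have hu : 1 + S p ∈ specialUnitaryGroup (Fin n) ℂ := by
    have hFp : F p.1 ∈ specialUnitaryGroup (Fin n) ℂ := hFs
    have h := mul_mem (star (⟨F p.1, hFp⟩ : specialUnitaryGroup (Fin n) ℂ)).2 hg
    have hs : star (F p.1) * F p.1 = 1 :=
      mem_unitaryGroup_iff'.1 (mem_specialUnitaryGroup_iff.1 hFp).1
    have hcoe : ((star (⟨F p.1, hFp⟩ : specialUnitaryGroup (Fin n) ℂ) : specialUnitaryGroup (Fin n) ℂ) : Matrix (Fin n) (Fin n) ℂ) = star (F p.1) := rfl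
    rw [hcoe, ← mul_assoc, hs, one_mul] at h
    exact h
  rw [hS, ← add_assoc] at hu
  have := smith_rigid p.2.1 p.2.2 h2 h3 h4 hu
  rw [hS, ← add_assoc, this, mul_one]
  exact h1

theorem smith_det_diff {n : ℕ} (A : Matrix (Fin n) (Fin n) ℂ) :
    DifferentiableAt ℝ (fun M : Matrix (Fin n) (Fin n) ℂ => M.det) A := by
  have he : ∀ i j, DifferentiableAt ℝ (fun M : Matrix (Fin n) (Fin n) ℂ => M i j) A := fun i j =>
    (LinearMap.toContinuousLinearMap (Matrix.entryLinearMap ℝ ℂ i j)).differentiableAt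
  simp only [Matrix.det_apply']
  refine DifferentiableAt.fun_sum fun σ _ => ?_
  refine DifferentiableAt.const_mul ?_ _
  exact (HasFDerivAt.finsetProd fun i _ => (he (σ i) i).hasFDerivAt).differentiableAt

open Filter Topology in
theorem smith_not_scalar {n : ℕ} (hn : 2 ≤ n) (c : ℝ → Matrix (Fin n) (Fin n) ℂ)
    (X : Matrix (Fin n) (Fin n) ℂ) (hc : HasDerivAt c X 0) (hc0 : c 0 = 1)
    (hdet : ∀ᶠ t in 𝓝 (0 : ℝ), (c t).det = 1) (hX : X ≠ 0) (r : ℝ) :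
    X ≠ (Complex.I * r) • (1 : Matrix (Fin n) (Fin n) ℂ) := by
  intro h
  have hr : r ≠ 0 := by
    rintro rfl
    simp at h
    exact hX h
  obtain ⟨L, hL⟩ := smith_det_diff (1 : Matrix (Fin n) (Fin n) ℂ)
  have h1 : HasDerivAt (fun t => (c t).det) (L X) 0 := by
    have hL' := hL
    rw [← hc0] at hL'
    exact hL'.comp_hasDerivAt (0 : ℝ) hc
  have h2 : L X = 0 := by
    have : HasDerivAt (fun t => (c t).det) 0 0 :=
      (hasDerivAt_const (0 : ℝ) (1 : ℂ)).congr_of_eventuallyEq hdet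
    exact h1.unique this
  have hlin : HasDerivAt (fun t : ℝ => (1 : Matrix (Fin n) (Fin n) ℂ) + t • X) X 0 := by
    have := ((hasDerivAt_id (0 : ℝ)).smul_const X).const_add (1 : Matrix (Fin n) (Fin n) ℂ)
    rw [one_smul] at this
    exact this
  have h3 : HasDerivAt (fun t : ℝ => ((1 : Matrix (Fin n) (Fin n) ℂ) + t • X).det) (L X) 0 := by
    have hL' := hL
    have e0 : (1 : Matrix (Fin n) (Fin n) ℂ) = 1 + (0 : ℝ) • X := by simp
    rw [e0] at hL'
    exact hL'.comp_hasDerivAt (0 : ℝ) hlin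
  have h4 : (fun t : ℝ => ((1 : Matrix (Fin n) (Fin n) ℂ) + t • X).det) =
      fun t : ℝ => (1 + (t : ℂ) * (Complex.I * r)) ^ n := by
    ext t
    have : (1 : Matrix (Fin n) (Fin n) ℂ) + t • X = (1 + (t : ℂ) * (Complex.I * r)) • 1 := by
      rw [h, add_smul, one_smul, mul_smul (t : ℂ)]
      rfl
    rw [this, Matrix.det_smul, Matrix.det_one, mul_one, Fintype.card_fin]
  rw [h4] at h3
  have h5 : HasDerivAt (fun t : ℝ => (1 + (t : ℂ) * (Complex.I * r)) ^ n) (n * (Complex.I * r)) 0 := by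
    have hb : HasDerivAt (fun t : ℝ => (1 + (t : ℂ) * (Complex.I * r))) (Complex.I * r) 0 := by
      have := ((Complex.ofRealCLM.hasDerivAt (x := (0 : ℝ))).mul_const (Complex.I * r)).const_add (1 : ℂ)
      simpa using this
    have := hb.fun_pow n
    simpa using this
  have h6 := h3.unique h5
  rw [h2] at h6
  have : (n : ℂ) ≠ 0 := by exact_mod_cast (by omega : n ≠ 0)
  have hr' : (r : ℂ) ≠ 0 := by exact_mod_cast hr
  exact mul_ne_zero this (mul_ne_zero Complex.I_ne_zero hr') h6.symm

open Filter Topology in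
/-- `V` is contained in the tangent image of a finite-dimensional family in `G`. -/
def SmithReach {n : ℕ} (G : Set (Matrix (Fin n) (Fin n) ℂ))
    (V : Submodule ℝ (Matrix (Fin n) (Fin n) ℂ)) : Prop :=
  ∃ (E : Type) (_ : NormedAddCommGroup E) (_ : NormedSpace ℝ E) (_ : CompleteSpace E)
    (F : E → Matrix (Fin n) (Fin n) ℂ) (F' : E →L[ℝ] Matrix (Fin n) (Fin n) ℂ),
    HasStrictFDerivAt F F' 0 ∧ F 0 = 1 ∧ (∀ᶠ e in 𝓝 (0 : E), F e ∈ G) ∧ ∀ v ∈ V, ∃ e, F' e = v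

open Filter Topology in
theorem smith_reach_sup {n : ℕ} (G : Set (Matrix (Fin n) (Fin n) ℂ))
    (hmul : ∀ a ∈ G, ∀ b ∈ G, a * b ∈ G)
    (V : Submodule ℝ (Matrix (Fin n) (Fin n) ℂ)) (hV : SmithReach G V)
    (c : ℝ → Matrix (Fin n) (Fin n) ℂ) (c' : ℝ →L[ℝ] Matrix (Fin n) (Fin n) ℂ)
    (hc : HasStrictFDerivAt c c' 0) (hc0 : c 0 = 1) (hcG : ∀ᶠ t in 𝓝 (0 : ℝ), c t ∈ G) :
    SmithReach G (V ⊔ Submodule.span ℝ {c' 1}) := by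
  obtain ⟨E, i1, i2, i3, F, F', hF, hF0, hFG, hFV⟩ := hV
  have h1 : HasStrictFDerivAt (fun p : E × ℝ => F p.1) (F' ∘L ContinuousLinearMap.fst ℝ E ℝ) 0 :=
    HasStrictFDerivAt.comp (g := F) (f := Prod.fst) _ hF hasStrictFDerivAt_fst
  have h2 : HasStrictFDerivAt (fun p : E × ℝ => c p.2) (c' ∘L ContinuousLinearMap.snd ℝ E ℝ) 0 :=
    HasStrictFDerivAt.comp (g := c) (f := Prod.snd) _ hc hasStrictFDerivAt_snd
  obtain ⟨L, hL, hLv⟩ := smith_mul_deriv h1 h2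
  refine ⟨E × ℝ, inferInstance, inferInstance, inferInstance, _, L, hL, ?_, ?_, ?_⟩
  · simp [hF0, hc0]
  · have e1 := (continuous_fst.tendsto' (0 : E × ℝ) 0 rfl).eventually hFG
    have e2 := (continuous_snd.tendsto' (0 : E × ℝ) 0 rfl).eventually hcG
    filter_upwards [e1, e2] with p h1 h2 using hmul _ h1 _ h2
  · intro v hv
    obtain ⟨y, hy, z, hz, rfl⟩ := Submodule.mem_sup.1 hv
    obtain ⟨e, rfl⟩ := hFV y hy
    obtain ⟨t, rfl⟩ := Submodule.mem_span_singleton.1 hz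
    refine ⟨(e, t), ?_⟩
    refine (hLv (e, t)).trans ?_
    change F 0 * c' t + F' e * c 0 = _
    have ht : c' t = t • c' 1 := by
      have := c'.map_smul t 1
      rwa [smul_eq_mul, mul_one] at this
    rw [hF0, hc0, one_mul, mul_one, add_comm, ht]

open Filter Topology in
theorem dense_subgroup_of_SU_with_analytic_arc_eq_SU {n : ℕ} (hn : 2 ≤ n)
    (Ghat : Set (Matrix (Fin n) (Fin n) ℂ))
    (hsub : Ghat ⊆ (Matrix.specialUnitaryGroup (Fin n) ℂ : Set (Matrix (Fin n) (Fin n) ℂ)))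
    (hone : (1 : Matrix (Fin n) (Fin n) ℂ) ∈ Ghat)
    (hmul : ∀ a ∈ Ghat, ∀ b ∈ Ghat, a * b ∈ Ghat)
    (hinv : ∀ a ∈ Ghat, star a ∈ Ghat)
    (hdense : (Matrix.specialUnitaryGroup (Fin n) ℂ : Set (Matrix (Fin n) (Fin n) ℂ)) ⊆
      closure Ghat)
    (a b : ℝ) (hab : a < b)
    (γ : ℝ → Matrix (Fin n) (Fin n) ℂ)
    (hanalytic : AnalyticOnNhd ℝ γ (Set.Ioo a b))
    (hγSU : ∀ t ∈ Set.Ioo a b,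
      γ t ∈ (Matrix.specialUnitaryGroup (Fin n) ℂ : Set (Matrix (Fin n) (Fin n) ℂ)))
    (hγG : ∀ t ∈ Set.Ioo a b, γ t ∈ Ghat)
    (hnonconst : ∃ t1 ∈ Set.Ioo a b, ∃ t2 ∈ Set.Ioo a b, γ t1 ≠ γ t2) :
    Ghat = (Matrix.specialUnitaryGroup (Fin n) ℂ : Set (Matrix (Fin n) (Fin n) ℂ)) := by
  have hSU1 : ∀ g ∈ Matrix.specialUnitaryGroup (Fin n) ℂ, g * star g = 1 := fun g hg =>
    Matrix.mem_unitaryGroup_iff.1 (Matrix.mem_specialUnitaryGroup_iff.1 hg).1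
  have hSU2 : ∀ g ∈ Matrix.specialUnitaryGroup (Fin n) ℂ, star g * g = 1 := fun g hg =>
    Matrix.mem_unitaryGroup_iff'.1 (Matrix.mem_specialUnitaryGroup_iff.1 hg).1
  have hSUs : ∀ g ∈ Matrix.specialUnitaryGroup (Fin n) ℂ,
      star g ∈ Matrix.specialUnitaryGroup (Fin n) ℂ := fun g hg =>
    (star (⟨g, hg⟩ : Matrix.specialUnitaryGroup (Fin n) ℂ)).2
  -- a point with nonzero derivative
  obtain ⟨t0, ht0, hD⟩ : ∃ t0 ∈ Set.Ioo a b, deriv γ t0 ≠ 0 := by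
    by_contra! hc
    obtain ⟨t1, h1, t2, h2, hne⟩ := hnonconst
    exact hne (isOpen_Ioo.is_const_of_deriv_eq_zero isPreconnected_Ioo
      hanalytic.differentiableOn (fun t ht => hc t ht) h1 h2)
  have hg0 := hγSU t0 ht0
  have hγd : HasStrictFDerivAt γ (fderiv ℝ γ t0) t0 := (hanalytic t0 ht0).hasStrictFDerivAt
  have hsh : HasStrictFDerivAt (fun t : ℝ => γ (t0 + t)) (fderiv ℝ γ t0) 0 := by
    have e0 : t0 = t0 + 0 := (add_zero t0).symm
    have hg : HasStrictFDerivAt γ (fderiv ℝ γ t0) (t0 + 0) := by rwa [← e0]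
    exact HasStrictFDerivAt.comp (g := γ) (f := fun t => t0 + t) 0 hg
      ((hasStrictFDerivAt_id (0 : ℝ)).const_add t0)
  have hshI : ∀ᶠ t in 𝓝 (0 : ℝ), t0 + t ∈ Set.Ioo a b := by
    have hcont : Continuous fun t : ℝ => t0 + t := by fun_prop
    exact (hcont.tendsto' 0 t0 (by simp)).eventually (isOpen_Ioo.mem_nhds ht0)
  -- conjugated curves
  have hcurve : ∀ g ∈ Ghat, ∃ c' : ℝ →L[ℝ] Matrix (Fin n) (Fin n) ℂ,
      HasStrictFDerivAt (fun t => g * (γ (t0 + t) * star (γ t0)) * star g) c' 0 ∧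
      c' 1 = g * (deriv γ t0 * star (γ t0)) * star g := by
    intro g hg
    obtain ⟨L1, hL1, hL1v⟩ := smith_mul_deriv hsh
      (hasStrictFDerivAt_const (𝕜 := ℝ) (star (γ t0)) (0 : ℝ))
    obtain ⟨L2, hL2, hL2v⟩ := smith_mul_deriv (hasStrictFDerivAt_const (𝕜 := ℝ) g (0 : ℝ)) hL1
    obtain ⟨L3, hL3, hL3v⟩ := smith_mul_deriv hL2
      (hasStrictFDerivAt_const (𝕜 := ℝ) (star g) (0 : ℝ))
    refine ⟨L3, hL3, ?_⟩
    have a1 : L1 1 = deriv γ t0 * star (γ t0) := by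
      refine (hL1v 1).trans ?_
      change γ (t0 + 0) * 0 + fderiv ℝ γ t0 1 * star (γ t0) = _
      rw [mul_zero, zero_add]
      rfl
    have a2 : L2 1 = g * (deriv γ t0 * star (γ t0)) := by
      refine (hL2v 1).trans ?_
      rw [a1]
      change _ + 0 * _ = _
      rw [zero_mul, add_zero]
    refine (hL3v 1).trans ?_
    rw [a2]
    change _ * 0 + _ = _
    rw [mul_zero, zero_add]
  obtain ⟨X, hXdef⟩ : ∃ X, X = deriv γ t0 * star (γ t0) := ⟨_, rfl⟩
  have hX0 : X ≠ 0 := by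
    intro h
    apply hD
    have : X * γ t0 = deriv γ t0 := by rw [hXdef, mul_assoc, hSU2 _ hg0, mul_one]
    rw [← this, h, zero_mul]
  obtain ⟨c', hc', hc'1⟩ := hcurve 1 hone
  simp only [star_one, one_mul, mul_one] at hc' hc'1
  rw [← hXdef] at hc'1
  have hcSU : ∀ᶠ t in 𝓝 (0 : ℝ), γ (t0 + t) * star (γ t0) ∈ Matrix.specialUnitaryGroup (Fin n) ℂ := by
    filter_upwards [hshI] with t ht
    exact mul_mem (hγSU _ ht) (hSUs _ hg0)
  have hc0 : γ (t0 + 0) * star (γ t0) = 1 := by rw [add_zero, hSU1 _ hg0]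
  have hXn := smith_not_scalar hn (fun t => γ (t0 + t) * star (γ t0)) X
    (by rw [← hc'1]; exact hc'.hasFDerivAt.hasDerivAt) hc0
    (by
      filter_upwards [hcSU] with t ht
      exact (Matrix.mem_specialUnitaryGroup_iff.1 ht).2) hX0
  have hXs : star X = -X := by
    have hst : HasStrictFDerivAt (fun t => star (γ (t0 + t) * star (γ t0)))
        (smithStar n ∘L c') 0 :=
      HasStrictFDerivAt.comp (g := smithStar n) (0 : ℝ) (smithStar n).hasStrictFDerivAt hc'
    obtain ⟨L, hL, hLv⟩ := smith_mul_deriv hc' hst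
    have hz : HasFDerivAt (fun t => (γ (t0 + t) * star (γ t0)) * star (γ (t0 + t) * star (γ t0)))
        (0 : ℝ →L[ℝ] Matrix (Fin n) (Fin n) ℂ) 0 := by
      refine (hasFDerivAt_const (1 : Matrix (Fin n) (Fin n) ℂ) (0 : ℝ)).congr_of_eventuallyEq ?_
      filter_upwards [hcSU] with t ht
      exact hSU1 _ ht
    have hL0 : L = 0 := hL.hasFDerivAt.unique hz
    have h := hLv 1
    rw [hL0] at h
    change 0 = (γ (t0 + 0) * star (γ t0)) * star (c' 1) + c' 1 * star (γ (t0 + 0) * star (γ t0)) at h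
    rw [hc0, hc'1, star_one, one_mul, mul_one] at h
    exact eq_neg_of_add_eq_zero_left h.symm
  -- maximal reachable subspace
  have hne : ({V | SmithReach Ghat V} : Set (Submodule ℝ (Matrix (Fin n) (Fin n) ℂ))).Nonempty := by
    refine ⟨⊥, ℝ, inferInstance, inferInstance, inferInstance, fun _ => 1, 0,
      hasStrictFDerivAt_const _ _, rfl, Eventually.of_forall fun _ => hone, ?_⟩
    intro v hv
    exact ⟨0, ((Submodule.mem_bot ℝ).1 hv).symm⟩
  obtain ⟨V, hV, hmax⟩ := WellFounded.has_min
    (wellFounded_gt (α := Submodule ℝ (Matrix (Fin n) (Fin n) ℂ))) _ hne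
  have hVG : ∀ g ∈ Ghat, g * X * star g ∈ V := by
    intro g hg
    obtain ⟨d', hd', hd'1⟩ := hcurve g hg
    have hr := smith_reach_sup Ghat hmul V hV _ d' hd'
      (by rw [hc0, mul_one, hSU1 _ (hsub hg)])
      (by
        filter_upwards [hshI] with t ht
        exact hmul _ (hmul _ hg _ (hmul _ (hγG _ ht) _ (hinv _ (hγG _ ht0)))) _ (hinv _ hg))
    have hle : V ⊔ Submodule.span ℝ {d' 1} ≤ V := by
      by_contra hcon
      exact hmax _ hr (lt_of_le_not_ge le_sup_left hcon)
    have := hle (Submodule.mem_sup_right (Submodule.mem_span_singleton_self (d' 1)))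
    rwa [hd'1, ← hXdef] at this
  have hVSU : ∀ g ∈ Matrix.specialUnitaryGroup (Fin n) ℂ, g * X * star g ∈ V := by
    intro g hg
    have hcont : Continuous fun g : Matrix (Fin n) (Fin n) ℂ => g * X * star g := by fun_prop
    have hcl : IsClosed (V : Set (Matrix (Fin n) (Fin n) ℂ)) := V.closed_of_finiteDimensional
    have : closure Ghat ⊆ (fun g : Matrix (Fin n) (Fin n) ℂ => g * X * star g) ⁻¹' V :=
      closure_minimal (fun g hg => hVG g hg) (hcl.preimage hcont)
    exact this (hdense hg)
  let V0 : Submodule ℝ (Matrix (Fin n) (Fin n) ℂ) :=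
    Submodule.span ℝ {v | ∃ g ∈ Matrix.specialUnitaryGroup (Fin n) ℂ, v = g * X * star g}
  have hV0 : V0 ≤ V := by
    refine Submodule.span_le.2 ?_
    rintro v ⟨g, hg, rfl⟩
    exact hVSU g hg
  have hV0inv : ∀ g ∈ Matrix.specialUnitaryGroup (Fin n) ℂ, ∀ v ∈ V0, g * v * star g ∈ V0 := by
    intro g hg v hv
    induction hv using Submodule.span_induction with
    | mem x hx =>
      obtain ⟨h, hh, rfl⟩ := hx
      refine Submodule.subset_span ⟨g * h, mul_mem hg hh, ?_⟩
      simp only [star_mul, mul_assoc]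
    | zero => simp
    | add x y _ _ hx hy => rw [mul_add, add_mul]; exact V0.add_mem hx hy
    | smul r x _ hx => rw [mul_smul_comm, smul_mul_assoc]; exact V0.smul_mem _ hx
  have hXV0 : X ∈ V0 := Submodule.subset_span ⟨1, one_mem _, by simp⟩
  have hall := fun Y h1 h2 => hV0 (smith_irred hn V0 hV0inv X hXV0 hXs hXn Y h1 h2)
  obtain ⟨E, i1, i2, i3, F, F', hF, hF0, hFG, hFV⟩ := hV
  have hloc := smith_local hn Ghat hsub F F' hF hF0 hFG fun Y h1 h2 => hFV Y (hall Y h1 h2)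
  refine Set.Subset.antisymm hsub ?_
  intro g hg
  have hcont : Continuous fun h : Matrix (Fin n) (Fin n) ℂ => star h * g := by fun_prop
  have hev := (hcont.tendsto' g 1 (hSU2 g hg)).eventually hloc
  obtain ⟨h, hh1, hh2⟩ := mem_closure_iff_nhds.1 (hdense hg) _ hev
  have h1 : star h * g ∈ Ghat := hh1 (mul_mem (hSUs _ (hsub hh2)) hg)
  have h2 := hmul _ hh2 _ h1
  rwa [← mul_assoc, hSU1 _ (hsub hh2), one_mul] at h2
end
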